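/- arXiv:2211.04819 — 2 statements merged into one kernel-verified Lean document; each statement's English description precedes it below -/
import Mathlib

section
/- Let d ≥ 3, let V be in the reverse Hölder class RH_q for some q > d/2, let ρ be the associated critical radius function, let 1 < p < ∞ and θ > 0. If the weight w belongs to A_p^{ρ,θ}(ℝ^d), then for every c ≥ 1 there exists C > 0 such that for every k ∈ ℕ and every ball B = B(x,r) with 0 < r ≤ cρ(x), one has w(2^k B) ≤ C 2^{k p(θ+d)} w(B), where 2^k B = B(x, 2^k r) and w(A) = ∫_A w(y)dy. -/
open MeasureTheory Metric

noncomputable section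

/-- Euclidean space `ℝ^d`. -/
abbrev Rd (d : ℕ) := EuclideanSpace ℝ (Fin d)

/-- The Lebesgue measure `|B(x,r)|` of a ball, as a real number. -/
noncomputable def ballVol (d : ℕ) (x : Rd d) (r : ℝ) : ℝ :=
  (volume (ball x r)).toReal

/-- The integral `∫_{B(x,r)} g`. -/
noncomputable def ballInt (d : ℕ) (x : Rd d) (r : ℝ) (g : Rd d → ℝ) : ℝ :=
  ∫ y in ball x r, g y

/-- The average `|B(x,r)|⁻¹ ∫_{B(x,r)} g`. -/
noncomputable def ballAvg (d : ℕ) (x : Rd d) (r : ℝ) (g : Rd d → ℝ) : ℝ :=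
  (ballVol d x r)⁻¹ * ballInt d x r g

/-- `V` is a nonnegative, locally integrable, not a.e. zero function in the
reverse Hölder class `RH_q(ℝ^d)`. -/
def IsRH (d : ℕ) (q : ℝ) (V : Rd d → ℝ) : Prop :=
  (∀ x, 0 ≤ V x) ∧ LocallyIntegrable V volume ∧
  ¬ (∀ᵐ x ∂(volume : Measure (Rd d)), V x = 0) ∧
  ∃ C > 0, ∀ x r, 0 < r →
    (ballAvg d x r (fun y => V y ^ q)) ^ (1/q) ≤ C * ballAvg d x r V

/-- The critical radius function `ρ(x) = sup{r > 0 : r^{2-d} ∫_{B(x,r)} V ≤ 1}`. -/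
noncomputable def criticalRadius (d : ℕ) (V : Rd d → ℝ) (x : Rd d) : ℝ :=
  sSup {r : ℝ | 0 < r ∧ r ^ (2 - (d : ℝ)) * ballInt d x r V ≤ 1}

/-- The weight `w` belongs to the class `A_p^{ρ,θ}(ℝ^d)`. -/
def MemAp (d : ℕ) (p θ : ℝ) (ρ : Rd d → ℝ) (w : Rd d → ℝ) : Prop :=
  (∀ x, 0 < w x) ∧ Measurable w ∧ LocallyIntegrable w volume ∧
  LocallyIntegrable (fun x => w x ^ (-(1/(p-1)))) volume ∧
  ∃ C > 0, ∀ x r, 0 < r →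
    (((1 + r / ρ x) ^ θ * ballVol d x r)⁻¹ * ballInt d x r w) *
      (((1 + r / ρ x) ^ θ * ballVol d x r)⁻¹ *
        ballInt d x r (fun y => w y ^ (-(1/(p-1))))) ^ (p-1) ≤ C

/-- `C` is an admissible constant in the definition of `BMO^α_{L,w}` for `f`. -/
def BMOBound (d : ℕ) (α : ℝ) (ρ w f : Rd d → ℝ) (C : ℝ) : Prop :=
  (∀ x₀ r₀, 0 < r₀ → r₀ < ρ x₀ →
    ballInt d x₀ r₀ (fun y => |f y - ballAvg d x₀ r₀ f|) ≤
      C * (ballVol d x₀ r₀ ^ α * ballInt d x₀ r₀ w)) ∧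
  (∀ x₀ r₀, ρ x₀ ≤ r₀ →
    ballInt d x₀ r₀ (fun y => |f y|) ≤
      C * (ballVol d x₀ r₀ ^ α * ballInt d x₀ r₀ w))

/-- `f` belongs to the space `BMO^α_{L,w}(ℝ^d)`. -/
def MemBMO (d : ℕ) (α : ℝ) (ρ w f : Rd d → ℝ) : Prop :=
  LocallyIntegrable f volume ∧ ∃ C > 0, BMOBound d α ρ w f C

/-- The norm `‖f‖_{BMO^α_{L,w}}`: the least admissible constant. -/
noncomputable def bmoNorm (d : ℕ) (α : ℝ) (ρ w f : Rd d → ℝ) : ℝ :=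
  sInf {C : ℝ | 0 < C ∧ BMOBound d α ρ w f C}

lemma integrableOn_ball_of_locallyIntegrable {d : ℕ} {g : Rd d → ℝ}
    (hg : LocallyIntegrable g volume) (x : Rd d) (r : ℝ) : IntegrableOn g (ball x r) :=
  (hg.integrableOn_isCompact (isCompact_closedBall x r)).mono_set ball_subset_closedBall

lemma ballVol_pos {d : ℕ} (x : Rd d) {r : ℝ} (hr : 0 < r) : 0 < ballVol d x r :=
  ENNReal.toReal_pos (measure_ball_pos _ _ hr).ne' measure_ball_lt_top.ne

lemma ballVol_mul {d : ℕ} (x : Rd d) {t r : ℝ} (ht : 0 < t) :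
    ballVol d x (t * r) = t ^ (d : ℝ) * ballVol d x r := by
  have h := Measure.addHaar_ball_mul_of_pos (volume : Measure (Rd d)) x ht r
  rw [finrank_euclideanSpace_fin, ← Measure.addHaar_ball_center volume x] at h
  rw [ballVol, h, ENNReal.toReal_mul, ENNReal.toReal_ofReal (by positivity), Real.rpow_natCast,
    ballVol]

lemma ballInt_nonneg {d : ℕ} {g : Rd d → ℝ} (hg : ∀ y, 0 ≤ g y) (x : Rd d) (r : ℝ) :
    0 ≤ ballInt d x r g :=
  setIntegral_nonneg measurableSet_ball fun y _ => hg y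

lemma ballInt_mono_radius {d : ℕ} {g : Rd d → ℝ} (hg : ∀ y, 0 ≤ g y)
    (hgi : LocallyIntegrable g volume) (x : Rd d) {r s : ℝ} (hrs : r ≤ s) :
    ballInt d x r g ≤ ballInt d x s g :=
  setIntegral_mono_set (integrableOn_ball_of_locallyIntegrable hgi x s)
    (Filter.Eventually.of_forall hg) (ball_subset_ball hrs).eventuallyLE

/-- Hölder's inequality applied to `1 = w^{1/p} w^{-1/p}` on a ball. -/
lemma ballVol_rpow_le {d : ℕ} {p : ℝ} (hp : 1 < p) {w : Rd d → ℝ} (hw : ∀ y, 0 < w y)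
    (hwm : Measurable w) (hwi : LocallyIntegrable w volume)
    (hσi : LocallyIntegrable (fun y => w y ^ (-(1 / (p - 1)))) volume) (x : Rd d) (r : ℝ) :
    ballVol d x r ^ p ≤
      ballInt d x r w * ballInt d x r (fun y => w y ^ (-(1 / (p - 1)))) ^ (p - 1) := by
  have hp0 : 0 < p := by linarith
  have hp1 : 0 < p - 1 := by linarith
  have hpq : p.HolderConjugate (p / (p - 1)) := Real.HolderConjugate.conjExponent hp
  have hf (y : Rd d) : (w y ^ (1 / p)) ^ p = w y := by
    rw [← Real.rpow_mul (hw y).le, one_div_mul_cancel hp0.ne', Real.rpow_one]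
  have hg (y : Rd d) : (w y ^ (-(1 / p))) ^ (p / (p - 1)) = w y ^ (-(1 / (p - 1))) := by
    rw [← Real.rpow_mul (hw y).le]
    congr 1
    field_simp
  have hfg (y : Rd d) : w y ^ (1 / p) * w y ^ (-(1 / p)) = 1 := by
    rw [← Real.rpow_add (hw y), add_neg_cancel, Real.rpow_zero]
  have hfL : MemLp (fun y => w y ^ (1 / p)) (ENNReal.ofReal p) (volume.restrict (ball x r)) := by
    refine (integrable_norm_rpow_iff (hwm.pow_const _).aestronglyMeasurable
      (by simpa using hp0) ENNReal.ofReal_ne_top).1 ?_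
    simp_rw [ENNReal.toReal_ofReal hp0.le, Real.norm_of_nonneg (Real.rpow_nonneg (hw _).le _), hf]
    exact integrableOn_ball_of_locallyIntegrable hwi x r
  have hgL : MemLp (fun y => w y ^ (-(1 / p))) (ENNReal.ofReal (p / (p - 1)))
      (volume.restrict (ball x r)) := by
    refine (integrable_norm_rpow_iff (hwm.pow_const _).aestronglyMeasurable
      (by simpa using hpq.symm.pos) ENNReal.ofReal_ne_top).1 ?_
    simp_rw [ENNReal.toReal_ofReal hpq.symm.pos.le,
      Real.norm_of_nonneg (Real.rpow_nonneg (hw _).le _), hg]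
    exact integrableOn_ball_of_locallyIntegrable hσi x r
  have hH := integral_mul_le_Lp_mul_Lq_of_nonneg hpq
    (Filter.Eventually.of_forall fun y => Real.rpow_nonneg (hw y).le _)
    (Filter.Eventually.of_forall fun y => Real.rpow_nonneg (hw y).le _) hfL hgL
  simp_rw [hf, hg, hfg] at hH
  have hvol : ∫ _ in ball x r, (1 : ℝ) = ballVol d x r := by
    simp [ballVol, Measure.real]
  have hW : 0 ≤ ballInt d x r w := ballInt_nonneg (fun y => (hw y).le) x r
  have hS : 0 ≤ ballInt d x r (fun y => w y ^ (-(1 / (p - 1)))) :=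
    ballInt_nonneg (fun y => Real.rpow_nonneg (hw y).le _) x r
  rw [hvol] at hH
  change _ ≤ ballInt d x r w ^ _ * ballInt d x r (fun y => w y ^ (-(1 / (p - 1)))) ^ _ at hH
  calc ballVol d x r ^ p
      ≤ (ballInt d x r w ^ (1 / p) *
          ballInt d x r (fun y => w y ^ (-(1 / (p - 1)))) ^ (1 / (p / (p - 1)))) ^ p :=
        Real.rpow_le_rpow ENNReal.toReal_nonneg hH hp0.le
    _ = _ := by
        rw [Real.mul_rpow (by positivity) (by positivity), ← Real.rpow_mul hW,
          ← Real.rpow_mul hS, one_div_mul_cancel hp0.ne', Real.rpow_one]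
        congr 2
        field_simp

/-- If `w ∈ A_p^{ρ,θ}(ℝ^d)`, then for every `c ≥ 1` there is `C > 0` with
`w(2^k B) ≤ C 2^{k p (θ + d)} w(B)` whenever `B = B(x,r)` with `0 < r ≤ c ρ(x)`. -/
theorem statement2 (d : ℕ) (hd : 3 ≤ d) (q : ℝ) (hq : (d : ℝ) / 2 < q)
    (V : Rd d → ℝ) (hV : IsRH d q V)
    (ρ : Rd d → ℝ) (hρ : ρ = criticalRadius d V) (hρpos : ∀ x, 0 < ρ x)
    (p θ : ℝ) (hp : 1 < p) (hθ : 0 < θ) (w : Rd d → ℝ) (hw : MemAp d p θ ρ w) :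
    ∀ c : ℝ, 1 ≤ c → ∃ C > 0, ∀ (k : ℕ) (x : Rd d) (r : ℝ), 0 < r → r ≤ c * ρ x →
      ballInt d x (2 ^ k * r) w ≤ C * 2 ^ ((k : ℝ) * (p * (θ + d))) * ballInt d x r w := by
  intro c hc
  obtain ⟨hwpos, hwm, hwi, hσi, C, hC, hA⟩ := hw
  have hp0 : 0 < p := by linarith
  have hp1 : 0 < p - 1 := by linarith
  refine ⟨C * ((2 * c) ^ θ) ^ p, by positivity, fun k x r hr hrc => ?_⟩
  have h2k : (1 : ℝ) ≤ 2 ^ k := one_le_pow₀ one_le_two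
  have hR : 0 < 2 ^ k * r := by positivity
  have hρx := hρpos x
  have hvol := ballVol_pos x hr
  have hvolR := ballVol_pos x hR
  have hscale : ballVol d x (2 ^ k * r) = (2 ^ k) ^ (d : ℝ) * ballVol d x r :=
    ballVol_mul x (by positivity)
  have hHolder := ballVol_rpow_le hp hwpos hwm hwi hσi x r
  have hSmono := ballInt_mono_radius (fun y => Real.rpow_nonneg (hwpos y).le _) hσi x
    (le_mul_of_one_le_left hr.le h2k)
  have hS := ballInt_nonneg (fun y => Real.rpow_nonneg (hwpos y).le (-(1 / (p - 1)))) x r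
  have hSR := hS.trans hSmono
  have hW := ballInt_nonneg (fun y => (hwpos y).le) x r
  have hWR := ballInt_nonneg (fun y => (hwpos y).le) x (2 ^ k * r)
  have hAR := hA x (2 ^ k * r) hR
  have hΨ : (1 + 2 ^ k * r / ρ x) ^ θ ≤ (2 * c * 2 ^ k) ^ θ := by
    refine Real.rpow_le_rpow (by positivity) ?_ hθ.le
    have h1 : 2 ^ k * r / ρ x ≤ 2 ^ k * c := by
      rw [mul_div_assoc]
      gcongr
      exact (div_le_iff₀ hρx).2 hrc
    nlinarith [mul_le_mul h2k hc zero_le_one (by positivity)]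
  have hpow : ((2 * c * 2 ^ k) ^ θ * ((2 ^ k) ^ (d : ℝ) * ballVol d x r)) ^ p =
      ((2 * c) ^ θ) ^ p * 2 ^ ((k : ℝ) * (p * (θ + d))) * ballVol d x r ^ p := by
    have htwo : (((2 : ℝ) ^ k) ^ θ) ^ p * (((2 : ℝ) ^ k) ^ (d : ℝ)) ^ p =
        2 ^ ((k : ℝ) * (p * (θ + d))) := by
      rw [← Real.rpow_mul (by positivity), ← Real.rpow_mul (by positivity),
        ← Real.rpow_add (by positivity), ← Real.rpow_natCast, ← Real.rpow_mul (by positivity)]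
      ring_nf
    rw [Real.mul_rpow (x := 2 * c) (by positivity) (by positivity),
      Real.mul_rpow (x := (2 * c) ^ θ * (2 ^ k) ^ θ) (by positivity) (by positivity),
      Real.mul_rpow (x := (2 * c) ^ θ) (by positivity) (by positivity),
      Real.mul_rpow (x := (2 ^ k) ^ (d : ℝ)) (by positivity) (by positivity), ← htwo]
    ring
  generalize ballInt d x r w = W at *
  generalize ballInt d x (2 ^ k * r) w = W' at *
  generalize ballInt d x r (fun y => w y ^ (-(1 / (p - 1)))) = S at *
  generalize ballInt d x (2 ^ k * r) (fun y => w y ^ (-(1 / (p - 1)))) = S' at *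
  generalize ballVol d x r = v at *
  generalize ballVol d x (2 ^ k * r) = v' at *
  have hΨpos : 0 < (1 + 2 ^ k * r / ρ x) ^ θ := by positivity
  generalize (1 + 2 ^ k * r / ρ x) ^ θ = Ψ at *
  have hAp : W' * S' ^ (p - 1) ≤ C * (Ψ * v') ^ p := by
    have hm : 0 < Ψ * v' := by positivity
    have hsplit : (Ψ * v') ^ p = (Ψ * v') * (Ψ * v') ^ (p - 1) := by
      rw [← Real.rpow_one_add' hm.le (by linarith)]
      ring_nf
    rw [Real.mul_rpow (by positivity) hSR, Real.inv_rpow hm.le] at hAR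
    rw [hsplit, ← div_le_iff₀ (by positivity)]
    refine le_of_eq_of_le ?_ hAR
    field_simp
  have hvp : 0 < v ^ p := by positivity
  refine le_of_mul_le_mul_right ?_ hvp
  calc W' * v ^ p ≤ W' * (W * S' ^ (p - 1)) := by
        gcongr
        exact hHolder.trans (by gcongr)
    _ = W * (W' * S' ^ (p - 1)) := by ring
    _ ≤ W * (C * (Ψ * v') ^ p) := by gcongr
    _ ≤ W * (C * ((2 * c * 2 ^ k) ^ θ * ((2 ^ k) ^ (d : ℝ) * v)) ^ p) := by
        rw [hscale] at *
        gcongr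
    _ = _ := by rw [hpow]; ring
end
end

section
/- Let d ≥ 3, let V be in the reverse Hölder class RH_q for some q > d/2, let ρ be the associated critical radius function, let 1 < p < ∞, θ > 0, α ∈ [0,1), ν ∈ (1, p'] with p' = p/(p−1), and let w ∈ A_p^{ρ,θ}(ℝ^d). For every c ≥ 1 there exists C > 0 such that for every f ∈ BMO^α_{L,w}(ℝ^d) and every ball B = B(x,r) with 0 < r ≤ cρ(x), one has |B|^{−α} ( w(B)^{−1} ∫_B |f(y) − f_B|^ν w(y)^{1−ν} dy )^{1/ν} ≤ C ‖f‖_{BMO^α_{L,w}}. -/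
open MeasureTheory Metric

noncomputable section

/-- A nested sequence of countable measurable partitions: `cell n z` is the cell of
generation `n` containing `z`. -/
structure NestedCells (X : Type*) [MeasurableSpace X] where
  cell : ℕ → X → Set X
  measurableSet_cell : ∀ n z, MeasurableSet (cell n z)
  mem_cell : ∀ n z, z ∈ cell n z
  cell_eq : ∀ {n z y}, y ∈ cell n z → cell n y = cell n z
  cell_succ_subset : ∀ n z, cell (n + 1) z ⊆ cell n z
  countable_range : ∀ n, (Set.range (cell n)).Countable

namespace NestedCells

variable {X : Type*} [MeasurableSpace X] (G : NestedCells X)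

theorem cell_subset {m n : ℕ} (h : m ≤ n) (z : X) : G.cell n z ⊆ G.cell m z := by
  induction n, h using Nat.le_induction with
  | base => exact subset_rfl
  | succ k _ ih => exact (G.cell_succ_subset k z).trans ih

theorem mem_symm {n : ℕ} {y z : X} (h : y ∈ G.cell n z) : z ∈ G.cell n y := by
  rw [G.cell_eq h]; exact G.mem_cell n z

/-- To compare two integrals over the region exhausted by a stopping rule, it suffices to compare
them on each cell where the rule stops for the first time. -/
theorem lintegral_stopped_le (μ : Measure X) (P : ℕ → X → Prop)
    (hP : ∀ n z y, y ∈ G.cell n z → P n z → P n y) (F H : X → ENNReal)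
    (h : ∀ n z, P n z → (∀ m < n, ¬ P m z) →
      ∫⁻ y in G.cell n z, F y ∂μ ≤ ∫⁻ y in G.cell n z, H y ∂μ) :
    MeasurableSet {z | ∃ n, P n z} ∧
    ∫⁻ y in {z | ∃ n, P n z}, F y ∂μ ≤ ∫⁻ y in {z | ∃ n, P n z}, H y ∂μ := by
  classical
  set S : Set (Set X) := {s | ∃ n z, s = G.cell n z ∧ P n z ∧ ∀ m < n, ¬ P m z} with hS
  have hcount : S.Countable := by
    refine (Set.countable_iUnion G.countable_range).mono ?_
    rintro s ⟨n, z, rfl, -⟩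
    exact Set.mem_iUnion.2 ⟨n, z, rfl⟩
  have hmeas : ∀ s ∈ S, MeasurableSet s := by
    rintro s ⟨n, z, rfl, -⟩
    exact G.measurableSet_cell n z
  have first : ∀ {n z y}, y ∈ G.cell n z → (∀ m < n, ¬ P m z) → ∀ m < n, ¬ P m y := by
    intro n z y hy hz m hm hPy
    exact hz m hm (hP m y z (G.mem_symm (G.cell_subset hm.le z hy)) hPy)
  have hdisj : S.PairwiseDisjoint id := by
    rintro s ⟨n, z, rfl, hz, hz'⟩ t ⟨n', z', rfl, hw, hw'⟩ hne
    refine Set.disjoint_left.2 fun y hy hy' => hne ?_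
    have h1 := hP _ _ _ hy hz
    have h2 := hP _ _ _ hy' hw
    have h3 := first hy hz'
    have h4 := first hy' hw'
    have hnn : n = n' := by
      rcases lt_trichotomy n n' with hlt | heq | hlt
      · exact (h4 n hlt h1).elim
      · exact heq
      · exact (h3 n' hlt h2).elim
    subst hnn
    exact (G.cell_eq hy).symm.trans (G.cell_eq hy')
  have hU : {z | ∃ n, P n z} = ⋃ s ∈ S, s := by
    ext y
    simp only [Set.mem_ofPred_eq, Set.mem_iUnion, exists_prop]
    constructor
    · intro hy
      exact ⟨_, ⟨Nat.find hy, y, rfl, Nat.find_spec hy, fun m hm => Nat.find_min hy hm⟩,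
        G.mem_cell _ _⟩
    · rintro ⟨s, ⟨n, z, rfl, hz, -⟩, hy⟩
      exact ⟨n, hP _ _ _ hy hz⟩
  rw [hU]
  refine ⟨MeasurableSet.biUnion hcount hmeas, ?_⟩
  rw [lintegral_biUnion hcount hmeas hdisj, lintegral_biUnion hcount hmeas hdisj]
  refine ENNReal.tsum_le_tsum ?_
  rintro ⟨s, n, z, rfl, hz, hz'⟩
  exact h n z hz hz'

end NestedCells

/-- The hypotheses of the weighted John–Nirenberg inequality along nested cells. The weight `W` is
only controlled on cells which are good, or whose parent is; on the transition between good and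
other cells the function `f` itself, rather than its oscillation, is controlled by `W`. -/
structure CellOscillation {X : Type*} [MeasurableSpace X] (G : NestedCells X) (μ : Measure X)
    (ν : ℝ) (f : X → ℝ) (W : X → ENNReal) (good : ℕ → X → Prop) (a : ℕ → X → ℝ)
    (C₁ C₂ C₃ : ENNReal) : Prop where
  aemeasurable : AEMeasurable f μ
  measurable_weight : Measurable W
  weight_ne_zero : ∀ z, W z ≠ 0
  weight_ne_top : ∀ z, W z ≠ ⊤
  lintegral_weight_ne_zero : ∀ n z, ∫⁻ y in G.cell n z, W y ∂μ ≠ 0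
  lintegral_weight_ne_top : ∀ n z, ∫⁻ y in G.cell n z, W y ∂μ ≠ ⊤
  good_congr : ∀ {n z y}, y ∈ G.cell n z → good n z → good n y
  exists_good : ∀ n z, ∃ m ≥ n, good m z
  osc : ∀ {n z}, good n z →
    ∫⁻ y in G.cell n z, ‖f y - a n z‖ₑ ∂μ ≤ C₁ * ∫⁻ y in G.cell n z, W y ∂μ
  doubling : ∀ {n z}, good n z →
    ∫⁻ y in G.cell n z, W y ∂μ ≤ C₂ * ∫⁻ y in G.cell (n + 1) z, W y ∂μ
  power : ∀ {n z}, (good n z ∨ ∃ k, n = k + 1 ∧ good k z) → ∀ (b : ℝ) (A : ENNReal),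
    ‖b‖ₑ * μ (G.cell n z) ≤ A * ∫⁻ y in G.cell n z, W y ∂μ →
    ‖b‖ₑ ^ ν * ∫⁻ y in G.cell n z, W y ^ (1 - ν) ∂μ ≤ C₃ * A ^ ν * ∫⁻ y in G.cell n z, W y ∂μ
  size_of_good_succ : ∀ {n z}, ¬ good n z → good (n + 1) z →
    ∫⁻ y in G.cell (n + 1) z, ‖f y‖ₑ ∂μ ≤ C₁ * ∫⁻ y in G.cell (n + 1) z, W y ∂μ
  size_of_good : ∀ {n z}, good n z → ¬ good (n + 1) z →
    ∫⁻ y in G.cell (n + 1) z, ‖f y‖ₑ ∂μ ≤ C₁ * ∫⁻ y in G.cell (n + 1) z, W y ∂μ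
  differentiation : ∀ (b : ℝ) (A : ENNReal), A ≠ ⊤ → ∀ᵐ z ∂μ,
    (∀ᶠ n in Filter.atTop,
      ∫⁻ y in G.cell n z, ‖f y - b‖ₑ ∂μ ≤ A * ∫⁻ y in G.cell n z, W y ∂μ) →
    ‖f z - b‖ₑ ≤ A * W z

/-- The integrand `|f - b|^ν W^(1-ν)`, with `|f - b|` truncated at height `M W`. -/
def truncPow {X : Type*} (ν : ℝ) (f : X → ℝ) (W : X → ENNReal) (M : ENNReal) (b : ℝ) (z : X) :
    ENNReal :=
  min ‖f z - b‖ₑ (M * W z) ^ ν * W z ^ (1 - ν)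

theorem rpow_mul_rpow_one_sub {x : ENNReal} (h0 : x ≠ 0) (ht : x ≠ ⊤) (ν : ℝ) :
    x ^ ν * x ^ (1 - ν) = x := by
  rw [← ENNReal.rpow_add _ _ h0 ht]; simp

theorem truncPow_le_mul {X : Type*} {ν : ℝ} (hν : 1 < ν) {f : X → ℝ} {W : X → ENNReal} {M : ENNReal}
    {b : ℝ} {z : X} (h0 : W z ≠ 0) (ht : W z ≠ ⊤) {A : ENNReal}
    (h : min ‖f z - b‖ₑ (M * W z) ≤ A * W z) :
    truncPow ν f W M b z ≤ A ^ ν * W z := by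
  calc truncPow ν f W M b z ≤ (A * W z) ^ ν * W z ^ (1 - ν) := by
        unfold truncPow; gcongr
    _ = A ^ ν * (W z ^ ν * W z ^ (1 - ν)) := by
        rw [ENNReal.mul_rpow_of_nonneg _ _ (by linarith), mul_assoc]
    _ = A ^ ν * W z := by rw [rpow_mul_rpow_one_sub h0 ht]

theorem truncPow_triangle {X : Type*} {ν : ℝ} (hν : 1 < ν) (f : X → ℝ) (W : X → ENNReal)
    (M : ENNReal) (b c : ℝ) (z : X) :
    truncPow ν f W M b z ≤
      2 ^ (ν - 1) * (truncPow ν f W M c z + ‖c - b‖ₑ ^ ν * W z ^ (1 - ν)) := by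
  unfold truncPow
  have h1 : ‖f z - b‖ₑ ≤ ‖f z - c‖ₑ + ‖c - b‖ₑ := by
    have : f z - b = (f z - c) + (c - b) := by ring
    rw [this]; exact enorm_add_le _ _
  have h2 : min ‖f z - b‖ₑ (M * W z) ≤ min ‖f z - c‖ₑ (M * W z) + ‖c - b‖ₑ := by
    rcases le_total ‖f z - c‖ₑ (M * W z) with h | h
    · rw [min_eq_left h]; exact (min_le_left _ _).trans h1
    · rw [min_eq_right h]; exact (min_le_right _ _).trans le_self_add
  calc _ ≤ (min ‖f z - c‖ₑ (M * W z) + ‖c - b‖ₑ) ^ ν * W z ^ (1 - ν) := by gcongr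
    _ ≤ (2 ^ (ν - 1) * (min ‖f z - c‖ₑ (M * W z) ^ ν + ‖c - b‖ₑ ^ ν)) * W z ^ (1 - ν) := by
        gcongr; exact ENNReal.rpow_add_le_mul_rpow_add_rpow _ _ hν.le
    _ = _ := by ring

namespace CellOscillation

variable {X : Type*} [MeasurableSpace X] {G : NestedCells X} {μ : Measure X}
  {ν : ℝ} {f : X → ℝ} {W : X → ENNReal} {good : ℕ → X → Prop} {a : ℕ → X → ℝ}
  {C₁ C₂ C₃ : ENNReal}

theorem lintegral_truncPow_triangle (h : CellOscillation G μ ν f W good a C₁ C₂ C₃) (hν : 1 < ν)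
    (M : ENNReal) (b c : ℝ) (s : Set X) :
    ∫⁻ z in s, truncPow ν f W M b z ∂μ ≤ 2 ^ (ν - 1) *
      (∫⁻ z in s, truncPow ν f W M c z ∂μ + ‖c - b‖ₑ ^ ν * ∫⁻ z in s, W z ^ (1 - ν) ∂μ) := by
  have hm : Measurable fun z => W z ^ (1 - ν) := h.measurable_weight.pow_const _
  rw [← lintegral_const_mul _ hm, ← lintegral_add_right _ (hm.const_mul _), ← lintegral_const_mul']
  · exact lintegral_mono fun z => truncPow_triangle hν f W M b c z
  · exact ENNReal.rpow_ne_top_of_nonneg (by linarith) (by simp)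

theorem enorm_sub_mul_le (h : CellOscillation G μ ν f W good a C₁ C₂ C₃) (b c : ℝ) (s : Set X) :
    ‖c - b‖ₑ * μ s ≤ ∫⁻ z in s, ‖f z - c‖ₑ ∂μ + ∫⁻ z in s, ‖f z - b‖ₑ ∂μ := by
  have hm : AEMeasurable (fun z => ‖f z - b‖ₑ) (μ.restrict s) :=
    (h.aemeasurable.restrict.sub_const b).enorm
  rw [← lintegral_add_right' _ hm, ← setLIntegral_const]
  refine lintegral_mono fun z => ?_
  have : c - b = -(f z - c) + (f z - b) := by ring
  rw [this]
  exact (enorm_add_le _ _).trans (by rw [enorm_neg])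

/-- On a good cell with a bad parent, the truncated integral of `f` is controlled. -/
theorem lintegral_good_succ_le (h : CellOscillation G μ ν f W good a C₁ C₂ C₃) (hν : 1 < ν)
    {M T : ENNReal}
    (hT : ∀ n z, good n z →
      ∫⁻ y in G.cell n z, truncPow ν f W M (a n z) y ∂μ ≤ T * ∫⁻ y in G.cell n z, W y ∂μ)
    {n : ℕ} {z : X} (hn : ¬ good n z) (hn' : good (n + 1) z) :
    ∫⁻ y in G.cell (n + 1) z, truncPow ν f W M 0 y ∂μ ≤
      2 ^ (ν - 1) * (T + C₃ * (C₁ + C₁) ^ ν) * ∫⁻ y in G.cell (n + 1) z, W y ∂μ := by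
  have h1 := h.enorm_sub_mul_le 0 (a (n + 1) z) (G.cell (n + 1) z)
  have h2 : ‖a (n + 1) z - 0‖ₑ * μ (G.cell (n + 1) z) ≤
      (C₁ + C₁) * ∫⁻ y in G.cell (n + 1) z, W y ∂μ := by
    rw [add_mul]
    refine h1.trans (add_le_add (h.osc hn') ?_)
    simpa using h.size_of_good_succ hn hn'
  have h3 := h.power (Or.inl hn') _ _ h2
  refine (h.lintegral_truncPow_triangle hν M 0 (a (n + 1) z) _).trans ?_
  rw [mul_assoc, add_mul]
  gcongr
  exact hT _ _ hn'

/-- On a bad cell, the truncated integral of `f` is controlled. -/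
theorem lintegral_bad_le (h : CellOscillation G μ ν f W good a C₁ C₂ C₃) (hν : 1 < ν)
    {M T : ENNReal}
    (hT : ∀ n z, good n z →
      ∫⁻ y in G.cell n z, truncPow ν f W M (a n z) y ∂μ ≤ T * ∫⁻ y in G.cell n z, W y ∂μ)
    {n : ℕ} {z : X} (hn : ¬ good n z) :
    ∫⁻ y in G.cell n z, truncPow ν f W M 0 y ∂μ ≤
      2 ^ (ν - 1) * (T + C₃ * (C₁ + C₁) ^ ν) * ∫⁻ y in G.cell n z, W y ∂μ := by
  set P : ℕ → X → Prop := fun m y => y ∈ G.cell n z ∧ n ≤ m ∧ good m y with hPdef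
  have hU : {y | ∃ m, P m y} = G.cell n z := by
    ext y
    constructor
    · rintro ⟨m, hy, -⟩; exact hy
    · intro hy
      obtain ⟨m, hm, hg⟩ := h.exists_good n y
      exact ⟨m, hy, hm, hg⟩
  have key := (G.lintegral_stopped_le μ P ?_ (truncPow ν f W M 0)
    (fun y => 2 ^ (ν - 1) * (T + C₃ * (C₁ + C₁) ^ ν) * W y) ?_).2
  · rwa [hU, lintegral_const_mul _ h.measurable_weight] at key
  · rintro m y y' hy' ⟨hy, hm, hg⟩
    exact ⟨by rw [← G.cell_eq hy]; exact G.cell_subset hm y hy', hm, h.good_congr hy' hg⟩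
  · rintro m y ⟨hy, hm, hg⟩ hfirst
    rw [lintegral_const_mul _ h.measurable_weight]
    have hny : ¬ good n y := fun hc => hn (h.good_congr (G.mem_symm hy) hc)
    obtain ⟨l, rfl⟩ : ∃ l, m = l + 1 := by
      refine Nat.exists_eq_succ_of_ne_zero ?_
      rintro rfl
      obtain rfl : n = 0 := by omega
      exact hny hg
    have hnl : n ≤ l := by
      by_contra hc
      obtain rfl : n = l + 1 := by omega
      exact hny hg
    exact h.lintegral_good_succ_le hν hT
      (fun hc => hfirst l (Nat.lt_succ_self l) ⟨hy, hnl, hc⟩) hg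

/-- One Calderón–Zygmund step: a bound `T` for the truncated integrals over all good cells
improves itself. -/
theorem lintegral_step (h : CellOscillation G μ ν f W good a C₁ C₂ C₃) (hν : 1 < ν)
    {M T A : ENNReal} (hA0 : A ≠ 0) (hAt : A ≠ ⊤) (hCA : C₁ ≤ A)
    (hT : ∀ n z, good n z →
      ∫⁻ y in G.cell n z, truncPow ν f W M (a n z) y ∂μ ≤ T * ∫⁻ y in G.cell n z, W y ∂μ)
    {n : ℕ} {z : X} (hn : good n z) :
    ∫⁻ y in G.cell n z, truncPow ν f W M (a n z) y ∂μ ≤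
      (A ^ ν + 2 ^ (ν - 1) * (C₃ * (C₁ + A * C₂) ^ ν) +
        2 ^ (ν - 1) * 2 ^ (ν - 1) * (T + C₃ * (C₁ + C₁) ^ ν + C₃ * (C₁ + A * C₂) ^ ν) *
          (C₁ / A)) * ∫⁻ y in G.cell n z, W y ∂μ := by
  classical
  set b := a n z with hb
  set K₀ := C₃ * (C₁ + C₁) ^ ν with hK₀
  set K := C₃ * (C₁ + A * C₂) ^ ν with hK
  set D : ENNReal := 2 ^ (ν - 1) with hD
  have hD1 : 1 ≤ D := ENNReal.one_le_rpow (by norm_num) (by linarith)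
  have hWm := h.measurable_weight
  have hWp : Measurable fun y => W y ^ (1 - ν) := hWm.pow_const _
  set small : ℕ → X → Prop := fun m y =>
    ∫⁻ u in G.cell m y, ‖f u - b‖ₑ ∂μ ≤ A * ∫⁻ u in G.cell m y, W u ∂μ with hsmall
  have small_congr : ∀ {m y y'}, y' ∈ G.cell m y → small m y → small m y' := by
    intro m y y' hy' hs
    simp only [hsmall] at hs ⊢
    rwa [G.cell_eq hy']
  have mem_congr : ∀ {m y y'}, n ≤ m → y ∈ G.cell n z → y' ∈ G.cell m y → y' ∈ G.cell n z := by
    intro m y y' hm hy hy'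
    rw [← G.cell_eq hy]; exact G.cell_subset hm y hy'
  set P : ℕ → X → Prop := fun m y => y ∈ G.cell n z ∧ n ≤ m ∧ ¬ small m y with hPdef
  have hP : ∀ m y y', y' ∈ G.cell m y → P m y → P m y' := by
    rintro m y y' hy' ⟨hy, hm, hs⟩
    exact ⟨mem_congr hm hy hy', hm, fun hc => hs (small_congr (G.mem_symm hy') hc)⟩
  set U : Set X := {y | ∃ m, P m y} with hU
  have hUsub : U ⊆ G.cell n z := by rintro y ⟨m, hy, -⟩; exact hy
  -- the weak type estimate
  obtain ⟨hUm, hweak⟩ := G.lintegral_stopped_le μ P hP (fun y => A * W y) (fun y => ‖f y - b‖ₑ) (by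
    rintro m y ⟨-, -, hs⟩ -
    rw [lintegral_const_mul _ hWm]
    exact (not_le.1 hs).le)
  have hwU : ∫⁻ y in U, W y ∂μ ≤ C₁ / A * ∫⁻ y in G.cell n z, W y ∂μ := by
    rw [lintegral_const_mul _ hWm] at hweak
    have h1 : A * ∫⁻ y in U, W y ∂μ ≤ C₁ * ∫⁻ y in G.cell n z, W y ∂μ :=
      hweak.trans ((lintegral_mono_set hUsub).trans (h.osc hn))
    rw [ENNReal.div_eq_inv_mul, mul_assoc]
    calc ∫⁻ y in U, W y ∂μ = A⁻¹ * (A * ∫⁻ y in U, W y ∂μ) := by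
          rw [← mul_assoc, ENNReal.inv_mul_cancel hA0 hAt, one_mul]
      _ ≤ _ := by gcongr
  -- the transition region from good to bad cells
  set R : ℕ → X → Prop := fun m y =>
    y ∈ G.cell n z ∧ ∃ k, m = k + 1 ∧ n ≤ k ∧ good k y ∧ ¬ good (k + 1) y ∧ small k y with hR
  have hRc : ∀ m y y', y' ∈ G.cell m y → R m y → R m y' := by
    rintro m y y' hy' ⟨hy, k, rfl, hk, hg, hg', hs⟩
    have hk' := G.cell_succ_subset k y hy'
    exact ⟨mem_congr hk hy hk', k, rfl, hk, h.good_congr hk' hg,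
      fun hc => hg' (h.good_congr (G.mem_symm hy') hc), small_congr hk' hs⟩
  set E : Set X := {y | ∃ m, R m y} with hE
  have hEsub : E ⊆ G.cell n z := by rintro y ⟨m, hy, -⟩; exact hy
  obtain ⟨hEm, htrans⟩ := G.lintegral_stopped_le μ R hRc (fun y => ‖b‖ₑ ^ ν * W y ^ (1 - ν))
    (fun y => K * W y) (by
    rintro m y ⟨hy, k, rfl, hk, hg, hg', hs⟩ -
    rw [lintegral_const_mul _ hWm, lintegral_const_mul _ hWp]
    have h1 := h.enorm_sub_mul_le 0 b (G.cell (k + 1) y)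
    refine h.power (Or.inr ⟨k, rfl, hg⟩) b _ ?_
    simp only [sub_zero] at h1
    refine h1.trans ?_
    rw [add_comm, add_mul]
    refine add_le_add (h.size_of_good hg hg') ?_
    calc _ ≤ ∫⁻ u in G.cell k y, ‖f u - b‖ₑ ∂μ := lintegral_mono_set (G.cell_succ_subset k y)
      _ ≤ A * ∫⁻ u in G.cell k y, W u ∂μ := hs
      _ ≤ A * (C₂ * ∫⁻ u in G.cell (k + 1) y, W u ∂μ) := by gcongr; exact h.doubling hg
      _ = _ := by ring)
  -- the estimate on the stopped cells
  set H : X → ENNReal := fun y => D * D * (T + K₀ + K) * W y +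
    D * E.indicator (fun y => ‖b‖ₑ ^ ν * W y ^ (1 - ν)) y with hH
  have hind : Measurable (E.indicator (fun y => ‖b‖ₑ ^ ν * W y ^ (1 - ν))) :=
    (hWp.const_mul _).indicator hEm
  have hHlin : ∀ s : Set X, ∫⁻ y in s, H y ∂μ = D * D * (T + K₀ + K) * ∫⁻ y in s, W y ∂μ +
      D * ∫⁻ y in s, E.indicator (fun y => ‖b‖ₑ ^ ν * W y ^ (1 - ν)) y ∂μ := by
    intro s
    rw [lintegral_add_left (hWm.const_mul _), lintegral_const_mul _ hWm,
      lintegral_const_mul _ hind]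
  have hUest := (G.lintegral_stopped_le μ P hP (truncPow ν f W M b) H (by
    rintro m y ⟨hy, hm, hs⟩ hfirst
    have hny : good n y := h.good_congr hy hn
    have hsn : small n y := by
      simp only [hsmall]
      rw [G.cell_eq hy]
      exact (h.osc hn).trans (by gcongr)
    obtain ⟨l, rfl⟩ : ∃ l, m = l + 1 := by
      refine Nat.exists_eq_succ_of_ne_zero ?_
      rintro rfl
      obtain rfl : n = 0 := by omega
      exact hs hsn
    have hnl : n ≤ l := by
      by_contra hc
      obtain rfl : n = l + 1 := by omega
      exact hs hsn
    have hsm : ∀ k, n ≤ k → k ≤ l → small k y := by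
      intro k hk hkl
      by_contra hc
      exact hfirst k (by omega) ⟨hy, hk, hc⟩
    rw [hHlin]
    by_cases hgg : good l y ∧ good (l + 1) y
    · refine le_trans ?_ le_self_add
      have h1 := h.enorm_sub_mul_le b (a (l + 1) y) (G.cell (l + 1) y)
      have h2 : ‖a (l + 1) y - b‖ₑ * μ (G.cell (l + 1) y) ≤
          (C₁ + A * C₂) * ∫⁻ u in G.cell (l + 1) y, W u ∂μ := by
        rw [add_mul]
        refine h1.trans (add_le_add (h.osc hgg.2) ?_)
        calc _ ≤ ∫⁻ u in G.cell l y, ‖f u - b‖ₑ ∂μ := lintegral_mono_set (G.cell_succ_subset l y)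
          _ ≤ A * ∫⁻ u in G.cell l y, W u ∂μ := hsm l hnl le_rfl
          _ ≤ A * (C₂ * ∫⁻ u in G.cell (l + 1) y, W u ∂μ) := by gcongr; exact h.doubling hgg.1
          _ = _ := by ring
      have h3 := h.power (Or.inl hgg.2) _ _ h2
      calc _ ≤ D * (T * ∫⁻ u in G.cell (l + 1) y, W u ∂μ + K * ∫⁻ u in G.cell (l + 1) y, W u ∂μ) := by
            refine (h.lintegral_truncPow_triangle hν M b (a (l + 1) y) _).trans ?_
            gcongr
            exact hT _ _ hgg.2
        _ = 1 * D * (T + K) * ∫⁻ u in G.cell (l + 1) y, W u ∂μ := by ring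
        _ ≤ _ := by
            gcongr
            exact le_self_add
    · -- the cell or its parent is bad
      have hbad : ∫⁻ u in G.cell (l + 1) y, truncPow ν f W M 0 u ∂μ ≤
          D * (T + K₀) * ∫⁻ u in G.cell (l + 1) y, W u ∂μ := by
        by_cases hg : good (l + 1) y
        · exact h.lintegral_good_succ_le hν hT (fun hc => hgg ⟨hc, hg⟩) hg
        · exact h.lintegral_bad_le hν hT hg
      have hsubE : G.cell (l + 1) y ⊆ E := by
        have hex : ∃ j, n < j ∧ ¬ good j y ∧ j ≤ l + 1 := by
          by_cases hg : good (l + 1) y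
          · refine ⟨l, ?_, fun hc => hgg ⟨hc, hg⟩, by omega⟩
            rcases hnl.lt_or_eq with hlt | rfl
            · exact hlt
            · exact (hgg ⟨hny, hg⟩).elim
          · exact ⟨l + 1, by omega, hg, le_rfl⟩
        set j := Nat.find hex with hj
        obtain ⟨hj1, hj2, hj3⟩ := Nat.find_spec hex
        obtain ⟨k, hk⟩ : ∃ k, j = k + 1 := Nat.exists_eq_succ_of_ne_zero (by omega)
        have hgk : good k y := by
          by_contra hc
          have hnk : n < k := by
            rcases lt_or_ge n k with h' | h'
            · exact h'
            · obtain rfl : n = k := by omega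
              exact (hc hny).elim
          exact Nat.find_min hex (m := k) (by omega) ⟨hnk, hc, by omega⟩
        have hRy : R (k + 1) y := by
          refine ⟨hy, k, rfl, by omega, hgk, ?_, hsm k (by omega) (by omega)⟩
          rw [← hk]; exact hj2
        intro y' hy'
        exact ⟨k + 1, hRc _ _ _ (G.cell_subset (by omega) y hy') hRy⟩
      have hindeq : ∫⁻ u in G.cell (l + 1) y, E.indicator (fun y => ‖b‖ₑ ^ ν * W y ^ (1 - ν)) u ∂μ =
          ‖b‖ₑ ^ ν * ∫⁻ u in G.cell (l + 1) y, W u ^ (1 - ν) ∂μ := by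
        rw [← lintegral_const_mul _ hWp]
        refine setLIntegral_congr_fun (G.measurableSet_cell _ _) fun u hu => ?_
        exact Set.indicator_of_mem (hsubE hu) _
      rw [hindeq]
      calc _ ≤ D * (D * (T + K₀) * ∫⁻ u in G.cell (l + 1) y, W u ∂μ +
            ‖b‖ₑ ^ ν * ∫⁻ u in G.cell (l + 1) y, W u ^ (1 - ν) ∂μ) := by
            refine (h.lintegral_truncPow_triangle hν M b 0 _).trans ?_
            gcongr
            rw [zero_sub, enorm_neg]
        _ = D * D * (T + K₀) * ∫⁻ u in G.cell (l + 1) y, W u ∂μ +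
            D * (‖b‖ₑ ^ ν * ∫⁻ u in G.cell (l + 1) y, W u ^ (1 - ν) ∂μ) := by ring
        _ ≤ _ := add_le_add (mul_le_mul' (mul_le_mul' le_rfl le_self_add) le_rfl) le_rfl)).2
  rw [hHlin] at hUest
  have hUest' : ∫⁻ y in U, truncPow ν f W M b y ∂μ ≤
      (D * D * (T + K₀ + K) * (C₁ / A) + D * K) * ∫⁻ y in G.cell n z, W y ∂μ := by
    refine hUest.trans ?_
    rw [add_mul, mul_assoc _ (C₁ / A), mul_assoc D K]
    gcongr
    calc _ ≤ ∫⁻ y, E.indicator (fun y => ‖b‖ₑ ^ ν * W y ^ (1 - ν)) y ∂μ :=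
          setLIntegral_le_lintegral _ _
      _ = ∫⁻ y in E, ‖b‖ₑ ^ ν * W y ^ (1 - ν) ∂μ := lintegral_indicator hEm _
      _ ≤ ∫⁻ y in E, K * W y ∂μ := htrans
      _ = K * ∫⁻ y in E, W y ∂μ := lintegral_const_mul _ hWm
      _ ≤ _ := by gcongr
  -- the estimate off the stopped cells
  have hoff : ∫⁻ y in G.cell n z \ U, truncPow ν f W M b y ∂μ ≤
      A ^ ν * ∫⁻ y in G.cell n z, W y ∂μ := by
    rw [← lintegral_const_mul _ hWm]
    refine le_trans ?_ (lintegral_mono_set (fun x hx => hx.1 : G.cell n z \ U ⊆ G.cell n z))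
    refine lintegral_mono_ae ?_
    filter_upwards [ae_restrict_of_ae (h.differentiation b A hAt),
      ae_restrict_mem ((G.measurableSet_cell n z).diff hUm)] with y hy hyU
    refine truncPow_le_mul hν (h.weight_ne_zero y) (h.weight_ne_top y)
      ((min_le_left _ _).trans (hy ?_))
    filter_upwards [Filter.eventually_ge_atTop n] with m hm
    by_contra hc
    exact hyU.2 ⟨m, hyU.1, hm, hc⟩
  calc ∫⁻ y in G.cell n z, truncPow ν f W M b y ∂μ
      = ∫⁻ y in U, truncPow ν f W M b y ∂μ + ∫⁻ y in G.cell n z \ U, truncPow ν f W M b y ∂μ := by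
        rw [← lintegral_inter_add_sdiff _ (G.cell n z) hUm, Set.inter_eq_self_of_subset_right hUsub]
    _ ≤ _ := add_le_add hUest' hoff
    _ = _ := by ring

theorem lintegral_truncPow_le (h : CellOscillation G μ ν f W good a C₁ C₂ C₃) (hν : 1 < ν)
    {M A : ENNReal} (hM : M ≠ ⊤) (hA0 : A ≠ 0) (hAt : A ≠ ⊤) (hCA : C₁ ≤ A)
    (hA : 2 ^ (ν - 1) * 2 ^ (ν - 1) * (C₁ / A) ≤ 2⁻¹) {n : ℕ} {z : X} (hn : good n z) :
    ∫⁻ y in G.cell n z, truncPow ν f W M (a n z) y ∂μ ≤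
      2 * (A ^ ν + 2 ^ (ν - 1) * (C₃ * (C₁ + A * C₂) ^ ν) +
        (C₃ * (C₁ + C₁) ^ ν + C₃ * (C₁ + A * C₂) ^ ν)) * ∫⁻ y in G.cell n z, W y ∂μ := by
  set K' : ENNReal := A ^ ν + 2 ^ (ν - 1) * (C₃ * (C₁ + A * C₂) ^ ν) +
    (C₃ * (C₁ + C₁) ^ ν + C₃ * (C₁ + A * C₂) ^ ν) with hK'
  set T : ENNReal := ⨆ (n : ℕ) (z : X) (_ : good n z),
    (∫⁻ y in G.cell n z, truncPow ν f W M (a n z) y ∂μ) / ∫⁻ y in G.cell n z, W y ∂μ with hTdef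
  have hT : ∀ n z, good n z →
      ∫⁻ y in G.cell n z, truncPow ν f W M (a n z) y ∂μ ≤ T * ∫⁻ y in G.cell n z, W y ∂μ := by
    intro n z hn
    rw [← ENNReal.div_le_iff (h.lintegral_weight_ne_zero n z) (h.lintegral_weight_ne_top n z)]
    exact le_iSup_of_le n (le_iSup_of_le z (le_iSup_of_le hn le_rfl))
  have hTtop : T ≠ ⊤ := by
    refine ne_top_of_le_ne_top (ENNReal.rpow_ne_top_of_nonneg (y := ν) (by linarith) hM) ?_
    refine iSup_le fun n => iSup_le fun z => iSup_le fun hn => ENNReal.div_le_of_le_mul ?_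
    rw [← lintegral_const_mul _ h.measurable_weight]
    exact lintegral_mono fun y => truncPow_le_mul hν (h.weight_ne_zero y) (h.weight_ne_top y)
      (min_le_right _ _)
  have hstep : T ≤ T / 2 + K' := by
    refine iSup_le fun n => iSup_le fun z => iSup_le fun hn => ENNReal.div_le_of_le_mul ?_
    refine (h.lintegral_step hν hA0 hAt hCA hT hn).trans ?_
    refine mul_le_mul' ?_ le_rfl
    calc _ = A ^ ν + 2 ^ (ν - 1) * (C₃ * (C₁ + A * C₂) ^ ν) +
        (2 ^ (ν - 1) * 2 ^ (ν - 1) * (C₁ / A)) *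
          (T + C₃ * (C₁ + C₁) ^ ν + C₃ * (C₁ + A * C₂) ^ ν) := by ring
      _ ≤ A ^ ν + 2 ^ (ν - 1) * (C₃ * (C₁ + A * C₂) ^ ν) +
        2⁻¹ * (T + C₃ * (C₁ + C₁) ^ ν + C₃ * (C₁ + A * C₂) ^ ν) := by gcongr
      _ = T / 2 + (A ^ ν + 2 ^ (ν - 1) * (C₃ * (C₁ + A * C₂) ^ ν) +
        2⁻¹ * (C₃ * (C₁ + C₁) ^ ν + C₃ * (C₁ + A * C₂) ^ ν)) := by
          rw [ENNReal.div_eq_inv_mul]; ring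
      _ ≤ T / 2 + (A ^ ν + 2 ^ (ν - 1) * (C₃ * (C₁ + A * C₂) ^ ν) +
        1 * (C₃ * (C₁ + C₁) ^ ν + C₃ * (C₁ + A * C₂) ^ ν)) := by
          gcongr; norm_num
      _ = _ := by rw [one_mul]
  have hT2 : T ≤ 2 * K' := by
    have h1 : T / 2 + T / 2 ≤ T / 2 + K' := by rwa [ENNReal.add_halves]
    have h2 : T / 2 ≤ K' :=
      (ENNReal.add_le_add_iff_left (ENNReal.div_ne_top hTtop (by norm_num))).1 h1
    rw [mul_comm]
    exact (ENNReal.div_le_iff (by norm_num) (by norm_num)).1 h2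
  exact (hT n z hn).trans (by gcongr)

/-- The weighted John–Nirenberg inequality along nested cells, with a truncation height `A` that is
large in terms of `ν` and `C₁`. -/
theorem lintegral_le (h : CellOscillation G μ ν f W good a C₁ C₂ C₃) (hν : 1 < ν)
    {A : ENNReal} (hA0 : A ≠ 0) (hAt : A ≠ ⊤) (hCA : C₁ ≤ A)
    (hA : 2 ^ (ν - 1) * 2 ^ (ν - 1) * (C₁ / A) ≤ 2⁻¹) {n : ℕ} {z : X} (hn : good n z) :
    ∫⁻ y in G.cell n z, ‖f y - a n z‖ₑ ^ ν * W y ^ (1 - ν) ∂μ ≤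
      2 * (A ^ ν + 2 ^ (ν - 1) * (C₃ * (C₁ + A * C₂) ^ ν) +
        (C₃ * (C₁ + C₁) ^ ν + C₃ * (C₁ + A * C₂) ^ ν)) * ∫⁻ y in G.cell n z, W y ∂μ := by
  have hpt : ∀ y, ‖f y - a n z‖ₑ ^ ν * W y ^ (1 - ν) =
      ⨆ M : ℕ, truncPow ν f W M (a n z) y := by
    intro y
    refine le_antisymm ?_ (iSup_le fun M => ?_)
    · have hne : ‖f y - a n z‖ₑ / W y ≠ ⊤ := ENNReal.div_ne_top (by simp) (h.weight_ne_zero y)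
      obtain ⟨M, hM⟩ := ENNReal.exists_nat_gt hne
      refine le_iSup_of_le M ?_
      have : ‖f y - a n z‖ₑ ≤ M * W y :=
        (ENNReal.div_le_iff (h.weight_ne_zero y) (h.weight_ne_top y)).1 hM.le
      rw [truncPow, min_eq_left this]
    · unfold truncPow
      gcongr
      exact min_le_left _ _
  simp_rw [hpt]
  rw [lintegral_iSup']
  · exact iSup_le fun M => h.lintegral_truncPow_le hν (by simp) hA0 hAt hCA hA hn
  · intro M
    have h1 : AEMeasurable (fun y => ‖f y - a n z‖ₑ) (μ.restrict (G.cell n z)) :=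
      (h.aemeasurable.restrict.sub_const _).enorm
    exact ((h1.min (h.measurable_weight.const_mul _).aemeasurable).pow_const _).mul
      (h.measurable_weight.pow_const _).aemeasurable
  · refine Filter.Eventually.of_forall fun y => ?_
    intro M N hMN
    simp only [truncPow]
    gcongr

end CellOscillation

section Grid

variable {d : ℕ}

/-- The grid of half-open dyadic cubes of side lengths `S / 2 ^ n` with `o` as a vertex. -/
def dyadicGrid (o : Rd d) (S : ℝ) : NestedCells (Rd d) where
  cell n z := {y | ∀ i, ⌊(y i - o i) / S * 2 ^ n⌋ = ⌊(z i - o i) / S * 2 ^ n⌋}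
  measurableSet_cell n z := by
    have : {y : Rd d | ∀ i, ⌊(y i - o i) / S * 2 ^ n⌋ = ⌊(z i - o i) / S * 2 ^ n⌋} =
        ⋂ i, (fun y : Rd d => ⌊(y i - o i) / S * 2 ^ n⌋) ⁻¹' {⌊(z i - o i) / S * 2 ^ n⌋} := by
      ext y; simp
    rw [this]
    refine MeasurableSet.iInter fun i => ?_
    have hm : Measurable fun y : Rd d => ⌊(y i - o i) / S * 2 ^ n⌋ := by
      refine Int.measurable_floor.comp ?_
      fun_prop
    exact hm (measurableSet_singleton _)
  mem_cell n z := fun i => rfl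
  cell_eq {n z y} hy := by
    ext u
    exact forall_congr' fun i => by rw [hy i]
  cell_succ_subset n z y hy i := by
    have key : ∀ t u : ℝ, ⌊t * 2⌋ = ⌊u * 2⌋ → ⌊t⌋ = ⌊u⌋ := by
      have half : ∀ t u : ℝ, ⌊t * 2⌋ = ⌊u * 2⌋ → ⌊t⌋ ≤ ⌊u⌋ := by
        intro t u h
        rw [Int.le_floor]
        have h1 : (⌊t⌋ : ℝ) ≤ t := Int.floor_le t
        have h2 : 2 * ⌊t⌋ ≤ ⌊t * 2⌋ := by
          rw [Int.le_floor]; push_cast; linarith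
        rw [h, Int.le_floor] at h2
        push_cast at h2
        linarith
      exact fun t u h => le_antisymm (half t u h) (half u t h.symm)
    refine key _ _ ?_
    have := hy i
    rwa [pow_succ, ← mul_assoc, ← mul_assoc] at this
  countable_range n := by
    refine (Set.countable_range fun k : Fin d → ℤ =>
      {y : Rd d | ∀ i, ⌊(y i - o i) / S * 2 ^ n⌋ = k i}).mono ?_
    rintro s ⟨z, rfl⟩
    exact ⟨fun i => ⌊(z i - o i) / S * 2 ^ n⌋, rfl⟩

theorem dist_lt_of_mem_dyadicGrid {o : Rd d} {S : ℝ} (hS : 0 < S) {n : ℕ} {y z : Rd d}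
    (h : y ∈ (dyadicGrid o S).cell n z) : dist y z < (d + 1) * (S / 2 ^ n) := by
  set s := S / 2 ^ n with hs
  have hs0 : 0 < s := by positivity
  have hi : ∀ i, |y i - z i| ≤ s := by
    intro i
    have h1 := (Int.abs_sub_lt_one_of_floor_eq_floor (h i)).le
    have h2 : (y i - o i) / S * 2 ^ n - (z i - o i) / S * 2 ^ n = (y i - z i) / s := by
      rw [hs]; field_simp; ring
    rw [h2, abs_div, abs_of_pos hs0, div_le_one hs0] at h1
    exact h1
  rw [EuclideanSpace.dist_eq]
  refine lt_of_le_of_lt (Real.sqrt_le_sqrt (y := (d * s) ^ 2) ?_) ?_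
  · calc ∑ i, dist (y i) (z i) ^ 2 ≤ ∑ _i : Fin d, s ^ 2 := by
          refine Finset.sum_le_sum fun i _ => ?_
          rw [Real.dist_eq]
          exact pow_le_pow_left₀ (abs_nonneg _) (hi i) 2
      _ = d * s ^ 2 := by simp
      _ ≤ (d * s) ^ 2 := by
          rw [mul_pow]
          have : (d : ℝ) ≤ (d : ℝ) ^ 2 := by exact_mod_cast Nat.le_self_pow (by norm_num) d
          gcongr
  · rw [Real.sqrt_sq (by positivity)]
    nlinarith

theorem exists_ball_subset_dyadicGrid {o : Rd d} {S : ℝ} (hS : 0 < S) (n : ℕ) (z : Rd d) :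
    ∃ c, ball c (S / 2 ^ n / 2) ⊆ (dyadicGrid o S).cell n z := by
  set s := S / 2 ^ n with hs
  have hs0 : 0 < s := by positivity
  refine ⟨WithLp.toLp 2 fun i => o i + s * (⌊(z i - o i) / S * 2 ^ n⌋ + 1 / 2), fun y hy i => ?_⟩
  have h1 := (PiLp.norm_apply_le (p := 2) (y - WithLp.toLp 2 fun i =>
    o i + s * (⌊(z i - o i) / S * 2 ^ n⌋ + 1 / 2)) i).trans_lt (mem_ball_iff_norm.1 hy)
  simp only [PiLp.sub_apply, Real.norm_eq_abs] at h1
  have h2 : (y i - o i) / S * 2 ^ n = (y i - o i) / s := by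
    rw [hs]; field_simp
  rw [h2, Int.floor_eq_iff, le_div_iff₀ hs0, div_lt_iff₀ hs0]
  rw [abs_lt] at h1
  constructor <;> nlinarith [h1.1, h1.2]

theorem ball_subset_dyadicGrid (x : Rd d) {r : ℝ} (hr : 0 < r) :
    ball x r ⊆ (dyadicGrid (WithLp.toLp 2 fun i => x i - r) (2 * r)).cell 0 x := by
  intro y hy i
  have h1 := (PiLp.norm_apply_le (p := 2) (y - x) i).trans_lt (mem_ball_iff_norm.1 hy)
  simp only [PiLp.sub_apply, Real.norm_eq_abs, abs_lt] at h1
  have h2 : ∀ t : ℝ, 0 ≤ t → t < 2 * r → ⌊t / (2 * r) * 2 ^ 0⌋ = 0 := by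
    intro t h0 ht
    rw [Int.floor_eq_zero_iff, pow_zero, mul_one]
    exact ⟨by positivity, (div_lt_one (by positivity)).2 ht⟩
  rw [h2, h2] <;> simp <;> linarith

theorem volume_ball_le (x y : Rd d) {t s L : ℝ} (hL : 0 < L) (h : t ≤ L * s) :
    volume (ball x t) ≤ ENNReal.ofReal (L ^ d) * volume (ball y s) := by
  have h1 := Measure.addHaar_ball_mul_of_pos (volume : Measure (Rd d)) x hL s
  rw [finrank_euclideanSpace_fin] at h1
  rw [Measure.addHaar_ball_center _ y, ← h1]
  exact measure_mono (ball_subset_ball h)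

end Grid

section Weights

variable {X : Type*} [MeasurableSpace X] {μ : Measure X} {W : X → ENNReal} {ν : ℝ}

/-- The Hölder inequality for the pair `W`, `W ^ (1 - ν)`. -/
theorem measure_rpow_le_lintegral_mul (hW : Measurable W) (h0 : ∀ z, W z ≠ 0)
    (ht : ∀ z, W z ≠ ⊤) (hν : 1 < ν) (E : Set X) :
    μ E ^ ν ≤ (∫⁻ y in E, W y ∂μ) ^ (ν - 1) * ∫⁻ y in E, W y ^ (1 - ν) ∂μ := by
  have hν0 : ν ≠ 0 := by positivity
  have h := ENNReal.lintegral_mul_norm_pow_le (μ := μ.restrict E) hW.aemeasurable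
    (hW.pow_const (1 - ν)).aemeasurable (p := (ν - 1) / ν) (q := 1 / ν)
    (div_nonneg (by linarith) (by linarith)) (by positivity) (by field_simp; ring)
  have h1 : ∀ y, W y ^ ((ν - 1) / ν) * (W y ^ (1 - ν)) ^ (1 / ν) = 1 := by
    intro y
    rw [← ENNReal.rpow_mul, ← ENNReal.rpow_add _ _ (h0 y) (ht y),
      show (ν - 1) / ν + (1 - ν) * (1 / ν) = 0 by field_simp; ring, ENNReal.rpow_zero]
  simp_rw [h1] at h
  rw [setLIntegral_one] at h
  calc μ E ^ ν ≤ ((∫⁻ y in E, W y ∂μ) ^ ((ν - 1) / ν) *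
        (∫⁻ y in E, W y ^ (1 - ν) ∂μ) ^ (1 / ν)) ^ ν := by gcongr
    _ = _ := by
      rw [ENNReal.mul_rpow_of_nonneg _ _ (by linarith), ← ENNReal.rpow_mul, ← ENNReal.rpow_mul,
        div_mul_cancel₀ _ hν0, one_div_mul_cancel hν0, ENNReal.rpow_one]

variable {C L : ENNReal} {E B : Set X}

theorem lintegral_rpow_ne_zero (hW : Measurable W) (ht : ∀ z, W z ≠ ⊤) (s : ℝ) (hs : s ≤ 0)
    (hE : μ E ≠ 0) : ∫⁻ y in E, W y ^ s ∂μ ≠ 0 := by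
  rw [← pos_iff_ne_zero, setLIntegral_pos_iff (hW.pow_const _)]
  have : (Function.support fun y => W y ^ s) = Set.univ := by
    ext y
    simp only [Function.mem_support, ne_eq, Set.mem_univ, iff_true, ENNReal.rpow_eq_zero_iff]
    rintro (⟨-, h⟩ | ⟨h, -⟩)
    · linarith
    · exact ht y h
  rw [this, Set.univ_inter]
  exact pos_iff_ne_zero.2 hE

theorem lintegral_ne_zero_of_measure_ne_zero (hW : Measurable W) (h0 : ∀ z, W z ≠ 0)
    (hE : μ E ≠ 0) : ∫⁻ y in E, W y ∂μ ≠ 0 := by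
  rw [← pos_iff_ne_zero, setLIntegral_pos_iff hW]
  have : (Function.support fun y => W y) = Set.univ := by
    ext y; simp [h0 y]
  rw [this, Set.univ_inter]
  exact pos_iff_ne_zero.2 hE

/-- A Muckenhoupt weight of exponent conjugate to `ν` on `B` is doubling with respect to subsets of comparable measure. -/
theorem lintegral_le_of_measure_le (hW : Measurable W) (h0 : ∀ z, W z ≠ 0) (ht : ∀ z, W z ≠ ⊤)
    (hν : 1 < ν) (hB : (∫⁻ y in B, W y ∂μ) ^ (ν - 1) * ∫⁻ y in B, W y ^ (1 - ν) ∂μ ≤ C * μ B ^ ν)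
    (hC : C ≠ ⊤) (hEB : E ⊆ B) (hBE : μ B ≤ L * μ E) (hE : μ E ≠ 0) (hBt : μ B ≠ ⊤) :
    ∫⁻ y in B, W y ∂μ ≤ (C * L ^ ν) ^ (1 / (ν - 1)) * ∫⁻ y in E, W y ∂μ := by
  have hν1 : 0 < ν - 1 := by linarith
  have hν0 : 0 < ν := by linarith
  set I := ∫⁻ y in E, W y ^ (1 - ν) ∂μ with hI
  have hI0 : I ≠ 0 := lintegral_rpow_ne_zero hW ht _ (by linarith) hE
  have hB0 : ∫⁻ y in B, W y ∂μ ≠ 0 :=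
    lintegral_ne_zero_of_measure_ne_zero hW h0
      (fun h => hE (measure_mono_null hEB h))
  have hIB : I ≤ ∫⁻ y in B, W y ^ (1 - ν) ∂μ := lintegral_mono_set hEB
  have h1 : (∫⁻ y in B, W y ∂μ) ^ (ν - 1) * I ≤ C * μ B ^ ν := le_trans (by gcongr) hB
  have hIt : I ≠ ⊤ := by
    intro h
    rw [h, ENNReal.mul_top (by simp [ENNReal.rpow_eq_zero_iff, hB0, hν.le])] at h1
    exact ENNReal.mul_ne_top hC (ENNReal.rpow_ne_top_of_nonneg hν0.le hBt) (top_le_iff.1 h1)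
  have h2 : (∫⁻ y in B, W y ∂μ) ^ (ν - 1) * I ≤
      C * L ^ ν * (∫⁻ y in E, W y ∂μ) ^ (ν - 1) * I := by
    calc _ ≤ C * μ B ^ ν := h1
      _ ≤ C * (L * μ E) ^ ν := by gcongr
      _ = C * L ^ ν * μ E ^ ν := by rw [ENNReal.mul_rpow_of_nonneg _ _ hν0.le, mul_assoc]
      _ ≤ C * L ^ ν * ((∫⁻ y in E, W y ∂μ) ^ (ν - 1) * I) := by
        gcongr; exact measure_rpow_le_lintegral_mul hW h0 ht hν E
      _ = _ := by rw [mul_assoc, mul_assoc, mul_assoc]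
  have h3 := (ENNReal.mul_le_mul_iff_left hI0 hIt).1 h2
  calc ∫⁻ y in B, W y ∂μ = ((∫⁻ y in B, W y ∂μ) ^ (ν - 1)) ^ (1 / (ν - 1)) := by
        rw [← ENNReal.rpow_mul, mul_one_div_cancel hν1.ne', ENNReal.rpow_one]
    _ ≤ (C * L ^ ν * (∫⁻ y in E, W y ∂μ) ^ (ν - 1)) ^ (1 / (ν - 1)) := by gcongr
    _ = _ := by
      rw [ENNReal.mul_rpow_of_nonneg _ _ (by positivity), ← ENNReal.rpow_mul _ (ν - 1),
        mul_one_div_cancel hν1.ne', ENNReal.rpow_one]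

theorem enorm_rpow_mul_lintegral_le (hW : Measurable W) (h0 : ∀ z, W z ≠ 0)
    (hν : 1 < ν) (hB : (∫⁻ y in B, W y ∂μ) ^ (ν - 1) * ∫⁻ y in B, W y ^ (1 - ν) ∂μ ≤ C * μ B ^ ν)
    (hEB : E ⊆ B) (hBE : μ B ≤ L * μ E) (hE : μ E ≠ 0)
    (hEt : ∫⁻ y in E, W y ∂μ ≠ ⊤) (b A : ENNReal)
    (hb : b * μ E ≤ A * ∫⁻ y in E, W y ∂μ) :
    b ^ ν * ∫⁻ y in E, W y ^ (1 - ν) ∂μ ≤ C * L ^ ν * A ^ ν * ∫⁻ y in E, W y ∂μ := by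
  have hν1 : 0 < ν - 1 := by linarith
  have hν0 : 0 < ν := by linarith
  set I := ∫⁻ y in E, W y ^ (1 - ν) ∂μ with hI
  set J := ∫⁻ y in E, W y ∂μ with hJ
  have hJ0 : J ≠ 0 := lintegral_ne_zero_of_measure_ne_zero hW h0 hE
  have hIB : I ≤ ∫⁻ y in B, W y ^ (1 - ν) ∂μ := lintegral_mono_set hEB
  have hJB : J ≤ ∫⁻ y in B, W y ∂μ := lintegral_mono_set hEB
  have h1 : J ^ (ν - 1) * I ≤ C * L ^ ν * μ E ^ ν :=
    calc J ^ (ν - 1) * I ≤ C * μ B ^ ν := le_trans (by gcongr) hB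
      _ ≤ C * (L * μ E) ^ ν := by gcongr
      _ = C * L ^ ν * μ E ^ ν := by rw [ENNReal.mul_rpow_of_nonneg _ _ hν0.le, mul_assoc]
  have h2 : J ^ (ν - 1) * (b ^ ν * I) ≤ J ^ (ν - 1) * (C * L ^ ν * A ^ ν * J) :=
    calc J ^ (ν - 1) * (b ^ ν * I) = b ^ ν * (J ^ (ν - 1) * I) := by ring
      _ ≤ b ^ ν * (C * L ^ ν * μ E ^ ν) := by gcongr
      _ = C * L ^ ν * (b * μ E) ^ ν := by rw [ENNReal.mul_rpow_of_nonneg _ _ hν0.le]; ring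
      _ ≤ C * L ^ ν * (A * J) ^ ν := by gcongr
      _ = C * L ^ ν * A ^ ν * (J ^ (ν - 1) * J ^ (1 : ℝ)) := by
        rw [ENNReal.mul_rpow_of_nonneg _ _ hν0.le, ← ENNReal.rpow_add _ _ hJ0 hEt,
          sub_add_cancel]; ring
      _ = _ := by rw [ENNReal.rpow_one]; ring
  exact (ENNReal.mul_le_mul_iff_right (by simp [ENNReal.rpow_eq_zero_iff, hJ0, hν.le])
    (ENNReal.rpow_ne_top_of_nonneg hν1.le hEt)).1 h2

end Weights

section LocalWeights

variable {d : ℕ} {p θ ν : ℝ} {ρ w : Rd d → ℝ}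

theorem MeasureTheory.LocallyIntegrable.integrableOn_ball {g : Rd d → ℝ}
    (hg : LocallyIntegrable g volume) (y : Rd d) (R : ℝ) : IntegrableOn g (ball y R) volume :=
  (hg.integrableOn_isCompact (isCompact_closedBall y R)).mono_set ball_subset_closedBall

theorem ofReal_ballInt {g : Rd d → ℝ} (hg : LocallyIntegrable g volume) (h0 : ∀ z, 0 ≤ g z)
    (y : Rd d) (R : ℝ) :
    ENNReal.ofReal (ballInt d y R g) = ∫⁻ z in ball y R, ENNReal.ofReal (g z) :=
  ofReal_integral_eq_lintegral_ofReal (hg.integrableOn_ball y R) (Filter.Eventually.of_forall h0)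

theorem ofReal_ballVol (y : Rd d) (R : ℝ) : ENNReal.ofReal (ballVol d y R) = volume (ball y R) :=
  ENNReal.ofReal_toReal measure_ball_lt_top.ne

theorem ballVol_pos_s3 (y : Rd d) {R : ℝ} (hR : 0 < R) : 0 < ballVol d y R :=
  ENNReal.toReal_pos (measure_ball_pos _ _ hR).ne' measure_ball_lt_top.ne

theorem MemAp.lintegral_mul_rpow_le (hw : MemAp d p θ ρ w) (hρ : ∀ x, 0 < ρ x) (hp : 1 < p)
    (hθ : 0 < θ) (κ : ℝ) : ∃ C : ENNReal, C ≠ ⊤ ∧ ∀ y R, 0 < R → R ≤ κ * ρ y →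
      (∫⁻ z in ball y R, ENNReal.ofReal (w z)) *
        (∫⁻ z in ball y R, ENNReal.ofReal (w z) ^ (-(1 / (p - 1)))) ^ (p - 1) ≤
          C * volume (ball y R) ^ p := by
  obtain ⟨hpos, hmeas, hint, hint', C, hC, h⟩ := hw
  refine ⟨ENNReal.ofReal (C * ((1 + κ) ^ θ) ^ p), ENNReal.ofReal_ne_top, fun y R hR hRκ => ?_⟩
  have hκ : R / ρ y ≤ κ := (div_le_iff₀ (hρ y)).2 hRκ
  have hT0 : 0 < R / ρ y := div_pos hR (hρ y)
  have hv := ballVol_pos_s3 y hR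
  have hp1 : 0 < p - 1 := by linarith
  set T := (1 + R / ρ y) ^ θ with hT
  have hTpos : 0 < T := by positivity
  have hTle : T ≤ (1 + κ) ^ θ := by rw [hT]; gcongr
  set v := ballVol d y R with hvdef
  have hu0 : ∀ z, 0 ≤ w z ^ (-(1 / (p - 1))) := fun z => Real.rpow_nonneg (hpos z).le _
  have hIu : 0 ≤ ballInt d y R (fun y => w y ^ (-(1 / (p - 1)))) :=
    integral_nonneg fun z => hu0 z
  have hIw : 0 ≤ ballInt d y R w := integral_nonneg fun z => (hpos z).le
  have h1 := h y R hR
  rw [Real.mul_rpow (by positivity) hIu] at h1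
  have h2 : ballInt d y R w * ballInt d y R (fun y => w y ^ (-(1 / (p - 1)))) ^ (p - 1) ≤
      C * ((1 + κ) ^ θ) ^ p * v ^ p := by
    have hp' : (T * v) * (T * v) ^ (p - 1) = (T * v) ^ p := by
      rw [← Real.rpow_one_add' (by positivity) (by linarith)]; congr 1; ring
    calc _ = (T * v)⁻¹ * ballInt d y R w * ((T * v)⁻¹ ^ (p - 1) *
          ballInt d y R (fun y => w y ^ (-(1 / (p - 1)))) ^ (p - 1)) *
          ((T * v) * (T * v) ^ (p - 1)) := by
          rw [Real.inv_rpow (by positivity)]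
          have : 0 < (T * v) ^ (p - 1) := by positivity
          field_simp
      _ ≤ C * ((T * v) * (T * v) ^ (p - 1)) := by gcongr
      _ = C * T ^ p * v ^ p := by rw [hp', Real.mul_rpow hTpos.le hv.le, mul_assoc]
      _ ≤ _ := by gcongr
  have h3 := ENNReal.ofReal_le_ofReal h2
  rw [ENNReal.ofReal_mul hIw, ENNReal.ofReal_mul (p := C * ((1 + κ) ^ θ) ^ p) (by
      have : 0 < 1 + κ := by linarith
      positivity), ← ENNReal.ofReal_rpow_of_nonneg hIu hp1.le,
    ← ENNReal.ofReal_rpow_of_nonneg hv.le (by linarith), ofReal_ballVol,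
    ofReal_ballInt hint (fun z => (hpos z).le), ofReal_ballInt hint' hu0] at h3
  simp_rw [← ENNReal.ofReal_rpow_of_pos (hpos _)] at h3
  exact h3

/-- On balls whose radius is controlled by the critical radius, an `A_p^{ρ,θ}` weight satisfies
a Muckenhoupt condition for every `ν` up to the conjugate exponent of `p`. -/
theorem MemAp.lintegral_rpow_mul_le (hw : MemAp d p θ ρ w) (hρ : ∀ x, 0 < ρ x) (hp : 1 < p)
    (hθ : 0 < θ) (hν : 1 < ν) (hν' : ν ≤ p / (p - 1)) (κ : ℝ) :
    ∃ C : ENNReal, C ≠ ⊤ ∧ ∀ y R, 0 < R → R ≤ κ * ρ y →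
      (∫⁻ z in ball y R, ENNReal.ofReal (w z)) ^ (ν - 1) *
        ∫⁻ z in ball y R, ENNReal.ofReal (w z) ^ (1 - ν) ≤ C * volume (ball y R) ^ ν := by
  obtain ⟨C, hC, h⟩ := hw.lintegral_mul_rpow_le hρ hp hθ κ
  have hν1 : 0 < ν - 1 := by linarith
  have hp1 : 0 < p - 1 := by linarith
  refine ⟨C ^ (ν - 1), ENNReal.rpow_ne_top_of_nonneg hν1.le hC, fun y R hR hRκ => ?_⟩
  set β := (ν - 1) * (p - 1) with hβ
  have hβ0 : 0 < β := by positivity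
  have hβ1 : β ≤ 1 := by
    rw [le_div_iff₀ hp1] at hν'
    rw [hβ]; linarith
  have hWm : Measurable fun z => ENNReal.ofReal (w z) := hw.2.1.ennreal_ofReal
  have hv0 : volume (ball y R) ≠ 0 := (measure_ball_pos _ _ hR).ne'
  have hvt : volume (ball y R) ≠ ⊤ := measure_ball_lt_top.ne
  have h1 := ENNReal.lintegral_mul_norm_pow_le (μ := volume.restrict (ball y R))
    (hWm.pow_const (-(1 / (p - 1)))).aemeasurable
    (aemeasurable_const (b := (1 : ENNReal))) (p := β) (q := 1 - β) hβ0.le (by linarith) (by ring)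
  simp only [ENNReal.one_rpow, mul_one, setLIntegral_one, ← ENNReal.rpow_mul] at h1
  rw [show -(1 / (p - 1)) * β = 1 - ν by rw [hβ]; field_simp; ring] at h1
  set v := volume (ball y R)
  set I := ∫⁻ z in ball y R, ENNReal.ofReal (w z)
  set U := ∫⁻ z in ball y R, ENNReal.ofReal (w z) ^ (-(1 / (p - 1)))
  calc _ ≤ I ^ (ν - 1) * (U ^ β * v ^ (1 - β)) := by gcongr
    _ = (I * U ^ (p - 1)) ^ (ν - 1) * v ^ (1 - β) := by
      rw [ENNReal.mul_rpow_of_nonneg _ _ hν1.le, ← ENNReal.rpow_mul, mul_comm (p - 1), mul_assoc]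
    _ ≤ (C * v ^ p) ^ (ν - 1) * v ^ (1 - β) := by
      exact mul_le_mul' (ENNReal.rpow_le_rpow (h y R hR hRκ) hν1.le) le_rfl
    _ = C ^ (ν - 1) * v ^ (p * (ν - 1) + (1 - β)) := by
      rw [ENNReal.mul_rpow_of_nonneg _ _ hν1.le, ← ENNReal.rpow_mul, mul_assoc,
        ← ENNReal.rpow_add _ _ hv0 hvt]
    _ = _ := by congr 2; rw [hβ]; ring

end LocalWeights

section Differentiation

variable {d : ℕ}

theorem volume_dyadicGrid_pos {o : Rd d} {S : ℝ} (hS : 0 < S) (n : ℕ) (z : Rd d) :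
    0 < volume ((dyadicGrid o S).cell n z) := by
  obtain ⟨c, hc⟩ := exists_ball_subset_dyadicGrid (o := o) hS n z
  exact (measure_ball_pos _ _ (by positivity)).trans_le (measure_mono hc)

theorem dyadicGrid_subset_ball {o : Rd d} {S : ℝ} (hS : 0 < S) (n : ℕ) (z : Rd d) :
    (dyadicGrid o S).cell n z ⊆ ball z ((d + 1) * (S / 2 ^ n)) :=
  fun _ hy => dist_lt_of_mem_dyadicGrid hS hy

theorem volume_dyadicGrid_ne_top {o : Rd d} {S : ℝ} (hS : 0 < S) (n : ℕ) (z : Rd d) :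
    volume ((dyadicGrid o S).cell n z) ≠ ⊤ :=
  ((measure_mono (dyadicGrid_subset_ball hS n z)).trans_lt measure_ball_lt_top).ne

/-- A ball is comparable in measure to any cell of comparable size. -/
theorem volume_ball_le_dyadicGrid {o : Rd d} {S : ℝ} (hS : 0 < S) (n : ℕ) (y z : Rd d) {t L : ℝ}
    (hL : 0 < L) (ht : t ≤ L * (S / 2 ^ n)) :
    volume (ball y t) ≤ ENNReal.ofReal ((2 * L) ^ d) * volume ((dyadicGrid o S).cell n z) := by
  obtain ⟨c, hc⟩ := exists_ball_subset_dyadicGrid (o := o) hS n z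
  calc _ ≤ ENNReal.ofReal ((2 * L) ^ d) * volume (ball c (S / 2 ^ n / 2)) :=
        volume_ball_le _ _ (by positivity) (by linarith)
    _ ≤ _ := by gcongr

theorem tendsto_div_two_pow (S : ℝ) : Filter.Tendsto (fun n : ℕ => S / 2 ^ n) Filter.atTop
    (nhds 0) := by
  have := (tendsto_pow_atTop_nhds_zero_of_lt_one (r := (1 / 2 : ℝ)) (by norm_num)
    (by norm_num)).const_mul S
  simpa [div_eq_mul_inv] using this

/-- The Lebesgue differentiation theorem along a dyadic grid. -/
theorem ae_tendsto_lintegral_dyadicGrid {g : Rd d → ℝ} (hg : LocallyIntegrable g volume)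
    (o : Rd d) {S : ℝ} (hS : 0 < S) :
    ∀ᵐ z, Filter.Tendsto (fun n => (∫⁻ y in (dyadicGrid o S).cell n z, ‖g y - g z‖ₑ) /
      volume ((dyadicGrid o S).cell n z)) Filter.atTop (nhds 0) := by
  filter_upwards [(Besicovitch.vitaliFamily
    (volume : Measure (Rd d))).ae_tendsto_lintegral_enorm_sub_div hg] with z hz
  have hr : Filter.Tendsto (fun n : ℕ => ((d : ℝ) + 1) * (S / 2 ^ n)) Filter.atTop
      (nhdsWithin 0 (Set.Ioi 0)) := by
    refine tendsto_nhdsWithin_iff.2 ⟨?_, Filter.Eventually.of_forall fun n => ?_⟩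
    · simpa using (tendsto_div_two_pow S).const_mul ((d : ℝ) + 1)
    · exact Set.mem_Ioi.2 (by positivity)
  have h := (hz.comp (Besicovitch.tendsto_filterAt volume z)).comp hr
  set L := ENNReal.ofReal ((2 * (2 * ((d : ℝ) + 1))) ^ d)
  have h' := ENNReal.Tendsto.const_mul (a := L) h (Or.inr ENNReal.ofReal_ne_top)
  rw [mul_zero] at h'
  refine tendsto_of_tendsto_of_tendsto_of_le_of_le tendsto_const_nhds h' (fun _ => zero_le)
    fun n => ?_
  have hE0 := (volume_dyadicGrid_pos (o := o) hS n z).ne'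
  have hEt := volume_dyadicGrid_ne_top (o := o) hS n z
  set E := (dyadicGrid o S).cell n z
  simp only [Function.comp_apply]
  have hsub : E ⊆ closedBall z ((d + 1) * (S / 2 ^ n)) :=
    (dyadicGrid_subset_ball hS n z).trans ball_subset_closedBall
  set B := closedBall z ((d + 1) * (S / 2 ^ n))
  have hBE : volume B ≤ L * volume E :=
    (measure_mono (closedBall_subset_ball (by
      have : 0 < ((d : ℝ) + 1) * (S / 2 ^ n) := by positivity
      linarith : ((d : ℝ) + 1) * (S / 2 ^ n) < 2 * ((d + 1) * (S / 2 ^ n))))).trans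
      (volume_ball_le_dyadicGrid hS n z z (L := 2 * ((d : ℝ) + 1)) (by positivity)
        (by rw [mul_assoc]))
  have hB0 : volume B ≠ 0 := fun h0 => hE0 (measure_mono_null hsub h0)
  have hBt : volume B ≠ ⊤ := measure_closedBall_lt_top.ne
  calc (∫⁻ y in E, ‖g y - g z‖ₑ) / volume E ≤ (∫⁻ y in B, ‖g y - g z‖ₑ) / volume E := by
        gcongr
    _ ≤ L * ((∫⁻ y in B, ‖g y - g z‖ₑ) / volume B) := by
      rw [ENNReal.div_le_iff hE0 hEt]
      calc (∫⁻ y in B, ‖g y - g z‖ₑ) = (∫⁻ y in B, ‖g y - g z‖ₑ) / volume B * volume B :=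
            (ENNReal.div_mul_cancel hB0 hBt).symm
        _ ≤ (∫⁻ y in B, ‖g y - g z‖ₑ) / volume B * (L * volume E) := by gcongr
        _ = _ := by ring

theorem ae_enorm_sub_le_dyadicGrid {f w : Rd d → ℝ} (hf : LocallyIntegrable f volume)
    (hw : LocallyIntegrable w volume) (hw0 : ∀ z, 0 ≤ w z) (o : Rd d) {S : ℝ} (hS : 0 < S)
    (b : ℝ) {A : ENNReal} (hA : A ≠ ⊤) :
    ∀ᵐ z, (∀ᶠ n in Filter.atTop, ∫⁻ y in (dyadicGrid o S).cell n z, ‖f y - b‖ₑ ≤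
      A * ∫⁻ y in (dyadicGrid o S).cell n z, ENNReal.ofReal (w y)) →
    ‖f z - b‖ₑ ≤ A * ENNReal.ofReal (w z) := by
  filter_upwards [ae_tendsto_lintegral_dyadicGrid hf o hS,
    ae_tendsto_lintegral_dyadicGrid hw o hS] with z hz hwz hev
  have hlim := ((hz.add (ENNReal.Tendsto.const_mul (a := A) hwz (Or.inr hA))).add
    (tendsto_const_nhds (x := A * ENNReal.ofReal (w z))))
  rw [mul_zero, add_zero, zero_add] at hlim
  refine ge_of_tendsto hlim (hev.mono fun n hn => ?_)
  have hE0 := (volume_dyadicGrid_pos (o := o) hS n z).ne'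
  have hEt := volume_dyadicGrid_ne_top (o := o) hS n z
  set E := (dyadicGrid o S).cell n z
  have h1 : ‖f z - b‖ₑ * volume E ≤ (∫⁻ y in E, ‖f y - f z‖ₑ) + ∫⁻ y in E, ‖f y - b‖ₑ := by
    rw [← setLIntegral_const, ← lintegral_add_left' (by
      exact (hf.aestronglyMeasurable.aemeasurable.restrict.sub_const _).enorm)]
    refine lintegral_mono fun y => ?_
    calc ‖f z - b‖ₑ = ‖(f z - f y) + (f y - b)‖ₑ := by rw [sub_add_sub_cancel]
      _ ≤ _ := (enorm_add_le _ _).trans_eq (by rw [← enorm_neg (f z - f y), neg_sub])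
  have h2 : ∫⁻ y in E, ENNReal.ofReal (w y) ≤
      (∫⁻ y in E, ‖w y - w z‖ₑ) + ENNReal.ofReal (w z) * volume E := by
    rw [← setLIntegral_const, ← lintegral_add_left' (by
      exact (hw.aestronglyMeasurable.aemeasurable.restrict.sub_const _).enorm)]
    refine lintegral_mono fun y => ?_
    rw [← Real.enorm_of_nonneg (hw0 y), ← Real.enorm_of_nonneg (hw0 z)]
    calc ‖w y‖ₑ = ‖(w y - w z) + w z‖ₑ := by rw [sub_add_cancel]
      _ ≤ _ := enorm_add_le _ _
  have h3 : ‖f z - b‖ₑ * volume E ≤ (∫⁻ y in E, ‖f y - f z‖ₑ) +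
      A * ((∫⁻ y in E, ‖w y - w z‖ₑ) + ENNReal.ofReal (w z) * volume E) :=
    h1.trans (by gcongr; exact hn.trans (by gcongr))
  have h4 := (ENNReal.le_div_iff_mul_le (Or.inl hE0) (Or.inl hEt)).2 h3
  refine h4.trans_eq ?_
  rw [ENNReal.add_div, mul_div_assoc, ENNReal.add_div, ENNReal.mul_div_cancel_right hE0 hEt]
  ring

end Differentiation

section CriticalCells

variable {d : ℕ} {ν K : ℝ} {ρ w f : Rd d → ℝ} {o : Rd d} {S : ℝ} {C : ENNReal}

/-- The cells containing a point at which the critical radius is at least `K⁻¹` times the side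
length of the cell. -/
def IsSubcritical (ρ : Rd d → ℝ) (K : ℝ) (o : Rd d) (S : ℝ) (n : ℕ) (z : Rd d) : Prop :=
  ∃ y ∈ (dyadicGrid o S).cell n z, S / 2 ^ n ≤ K * ρ y

/-- The measure of a concentric ball of radius `2 (d + 1)` times the side length of a dyadic cube
is at most this multiple of the measure of each of its children. -/
def dilationConst (d : ℕ) : ENNReal := ENNReal.ofReal ((2 * (4 * ((d : ℝ) + 1))) ^ d)

/-- The doubling constant of a weight satisfying `LocalAp` with constant `C`, for the dilations measured by
`dilationConst`. -/
def doublingConst (d : ℕ) (ν : ℝ) (C : ENNReal) : ENNReal :=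
  (C * dilationConst d ^ ν) ^ (1 / (ν - 1))

theorem dilationConst_ne_top : dilationConst d ≠ ⊤ := ENNReal.ofReal_ne_top

theorem doublingConst_ne_top (hν : 1 < ν) (hC : C ≠ ⊤) : doublingConst d ν C ≠ ⊤ := by
  have : 0 < ν - 1 := by linarith
  exact ENNReal.rpow_ne_top_of_nonneg (by positivity)
    (ENNReal.mul_ne_top hC (ENNReal.rpow_ne_top_of_nonneg (by linarith) dilationConst_ne_top))

/-- The Muckenhoupt condition, of exponent conjugate to `ν`, on balls of radius at most `κ ρ`. -/
def LocalAp (ρ w : Rd d → ℝ) (ν κ : ℝ) (C : ENNReal) : Prop :=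
  ∀ y R, 0 < R → R ≤ κ * ρ y →
    (∫⁻ z in ball y R, ENNReal.ofReal (w z)) ^ (ν - 1) *
      ∫⁻ z in ball y R, ENNReal.ofReal (w z) ^ (1 - ν) ≤ C * volume (ball y R) ^ ν

theorem LocalAp.lintegral_ball_le (hm : Measurable w) (h0 : ∀ z, 0 < w z) (hν : 1 < ν)
    (hA : LocalAp ρ w ν (2 * (d + 1) * K) C) (hC : C ≠ ⊤) {y : Rd d} {s : ℝ} (hs : 0 < s)
    (hy : s ≤ K * ρ y) {E : Set (Rd d)} (hE : E ⊆ ball y (2 * (d + 1) * s)) (hE0 : volume E ≠ 0)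
    (hvol : volume (ball y (2 * (d + 1) * s)) ≤ dilationConst d * volume E) :
    ∫⁻ z in ball y (2 * (d + 1) * s), ENNReal.ofReal (w z) ≤
      doublingConst d ν C * ∫⁻ z in E, ENNReal.ofReal (w z) :=
  lintegral_le_of_measure_le hm.ennreal_ofReal (fun z => by simp [h0 z])
    (fun z => ENNReal.ofReal_ne_top) hν (hA y _ (by positivity) (by rw [mul_assoc _ K]; gcongr)) hC
    hE hvol hE0 measure_ball_lt_top.ne

theorem LocalAp.enorm_rpow_mul_le (hm : Measurable w) (h0 : ∀ z, 0 < w z)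
    (hw : LocallyIntegrable w volume) (hν : 1 < ν)
    (hA : LocalAp ρ w ν (2 * (d + 1) * K) C) {y : Rd d} {s : ℝ} (hs : 0 < s)
    (hy : s ≤ K * ρ y) {E : Set (Rd d)} (hE : E ⊆ ball y (2 * (d + 1) * s)) (hE0 : volume E ≠ 0)
    (hvol : volume (ball y (2 * (d + 1) * s)) ≤ dilationConst d * volume E) (b A : ENNReal)
    (hb : b * volume E ≤ A * ∫⁻ z in E, ENNReal.ofReal (w z)) :
    b ^ ν * ∫⁻ z in E, ENNReal.ofReal (w z) ^ (1 - ν) ≤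
      C * dilationConst d ^ ν * A ^ ν * ∫⁻ z in E, ENNReal.ofReal (w z) := by
  refine enorm_rpow_mul_lintegral_le hm.ennreal_ofReal (fun z => by simp [h0 z]) hν
    (hA y _ (by positivity) (by rw [mul_assoc _ K]; gcongr)) hE hvol hE0 ?_ b A hb
  refine ((lintegral_mono_set hE).trans_lt ?_).ne
  rw [← ofReal_ballInt hw (fun z => (h0 z).le)]
  exact ENNReal.ofReal_lt_top

theorem dyadicGrid_subset_ball_of_mem (hS : 0 < S) {n : ℕ} {y z : Rd d}
    (hy : y ∈ (dyadicGrid o S).cell n z) :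
    (dyadicGrid o S).cell n z ⊆ ball y (2 * (d + 1) * (S / 2 ^ n)) := by
  rw [← (dyadicGrid o S).cell_eq hy]
  refine (dyadicGrid_subset_ball hS n y).trans (ball_subset_ball ?_)
  have : 0 < ((d : ℝ) + 1) * (S / 2 ^ n) := by positivity
  linarith

theorem volume_ball_le_dilationConst (hS : 0 < S) (n : ℕ) (y z : Rd d) :
    volume (ball y (2 * (d + 1) * (S / 2 ^ n))) ≤
      dilationConst d * volume ((dyadicGrid o S).cell (n + 1) z) :=
  volume_ball_le_dyadicGrid hS (n + 1) y z (by positivity) (by rw [pow_succ]; field_simp; norm_num)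

/-- A function whose normalized oscillation is controlled by `w` satisfies the hypotheses of the
weighted John–Nirenberg inequality on dyadic grids. -/
theorem exists_cellOscillation (hρ : ∀ x, 0 < ρ x) (hm : Measurable w) (h0 : ∀ z, 0 < w z)
    (hw : LocallyIntegrable w volume) (hν : 1 < ν) (hK : 1 ≤ K)
    (hA : LocalAp ρ w ν (2 * (d + 1) * K) C) (hC : C ≠ ⊤) (hf : LocallyIntegrable f volume)
    (hS : 0 < S)
    (hosc : ∀ y t, 0 < t → t ≤ 2 * (d + 1) * S →
      ∃ c, ∫⁻ z in ball y t, ‖f z - c‖ₑ ≤ ∫⁻ z in ball y t, ENNReal.ofReal (w z))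
    (hsize : ∀ y t, t ≤ 2 * (d + 1) * S → ρ y ≤ t →
      ∫⁻ z in ball y t, ‖f z‖ₑ ≤ ∫⁻ z in ball y t, ENNReal.ofReal (w z)) :
    ∃ a : ℕ → Rd d → ℝ, CellOscillation (dyadicGrid o S) volume ν f
      (fun z => ENNReal.ofReal (w z)) (IsSubcritical ρ K o S) a (doublingConst d ν C)
      (doublingConst d ν C) (C * dilationConst d ^ ν) := by
  classical
  have hs : ∀ n, 0 < S / 2 ^ n := fun n => by positivity
  have hsS : ∀ n, S / 2 ^ n ≤ S := fun n => div_le_self hS.le (one_le_pow₀ (by norm_num))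
  have hd1 : (1 : ℝ) ≤ d + 1 := by simp
  have hvol0 : ∀ n z, volume ((dyadicGrid o S).cell n z) ≠ 0 :=
    fun n z => (volume_dyadicGrid_pos hS n z).ne'
  have hKρ : ∀ y, ρ y ≤ K * ρ y := fun y => le_mul_of_one_le_left (hρ y).le hK
  have hvol : ∀ n y z, volume (ball y (2 * (d + 1) * (S / 2 ^ n))) ≤
      dilationConst d * volume ((dyadicGrid o S).cell n z) := fun n y z =>
    (volume_ball_le_dilationConst hS n y z).trans
      (by gcongr; exact (dyadicGrid o S).cell_succ_subset n z)
  have hsub : ∀ {n y z}, y ∈ (dyadicGrid o S).cell n z → (dyadicGrid o S).cell (n + 1) z ⊆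
      ball y (2 * (d + 1) * (S / 2 ^ n)) := fun hy =>
    ((dyadicGrid o S).cell_succ_subset _ _).trans (dyadicGrid_subset_ball_of_mem hS hy)
  have hcell : ∀ {n z}, IsSubcritical ρ K o S n z → ∃ c,
      ∫⁻ y in (dyadicGrid o S).cell n z, ‖f y - c‖ₑ ≤
        doublingConst d ν C * ∫⁻ y in (dyadicGrid o S).cell n z, ENNReal.ofReal (w y) := by
    rintro n z ⟨y, hy, hyK⟩
    obtain ⟨c, hc⟩ := hosc y (2 * (d + 1) * (S / 2 ^ n)) (by positivity)
      (by have := hsS n; gcongr)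
    refine ⟨c, (lintegral_mono_set (dyadicGrid_subset_ball_of_mem hS hy)).trans (hc.trans ?_)⟩
    exact hA.lintegral_ball_le hm h0 hν hC (hs n) hyK (dyadicGrid_subset_ball_of_mem hS hy)
      (hvol0 n z) (hvol n y z)
  refine ⟨fun n z => if h : IsSubcritical ρ K o S n z then (hcell h).choose else 0, ?_⟩
  constructor
  · exact hf.aestronglyMeasurable.aemeasurable
  · exact hm.ennreal_ofReal
  · exact fun z => by simp [h0 z]
  · exact fun z => ENNReal.ofReal_ne_top
  · exact fun n z => lintegral_ne_zero_of_measure_ne_zero hm.ennreal_ofReal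
      (fun z => by simp [h0 z]) (hvol0 n z)
  · intro n z
    refine ((lintegral_mono_set (dyadicGrid_subset_ball hS n z)).trans_lt ?_).ne
    rw [← ofReal_ballInt hw (fun z => (h0 z).le)]
    exact ENNReal.ofReal_lt_top
  · rintro n z y hy ⟨x, hx, hxK⟩
    exact ⟨x, by rwa [(dyadicGrid o S).cell_eq hy], hxK⟩
  · intro n z
    have hz : 0 < K * ρ z := mul_pos (by linarith) (hρ z)
    obtain ⟨m, hm1, hm2⟩ := (((tendsto_div_two_pow S).eventually (gt_mem_nhds hz)).and
      (Filter.eventually_ge_atTop n)).exists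
    exact ⟨m, hm2, z, (dyadicGrid o S).mem_cell m z, hm1.le⟩
  · intro n z hz
    simp only [hz, dif_pos]
    exact (hcell hz).choose_spec
  · rintro n z ⟨y, hy, hyK⟩
    exact (lintegral_mono_set (dyadicGrid_subset_ball_of_mem hS hy)).trans
      (hA.lintegral_ball_le hm h0 hν hC (hs n) hyK (hsub hy) (hvol0 _ z)
        (volume_ball_le_dilationConst hS n y z))
  · rintro n z (⟨y, hy, hyK⟩ | ⟨k, rfl, y, hy, hyK⟩) b A hb
    · exact hA.enorm_rpow_mul_le hm h0 hw hν (hs n) hyK (dyadicGrid_subset_ball_of_mem hS hy)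
        (hvol0 n z) (hvol n y z) _ A hb
    · exact hA.enorm_rpow_mul_le hm h0 hw hν (hs k) hyK (hsub hy) (hvol0 _ z)
        (volume_ball_le_dilationConst hS k y z) _ A hb
  · rintro n z hn ⟨y, hy, hyK⟩
    have hny : K * ρ y < S / 2 ^ n := not_le.1 fun h =>
      hn ⟨y, (dyadicGrid o S).cell_succ_subset n z hy, h⟩
    have hρy : ρ y ≤ 2 * (d + 1) * (S / 2 ^ (n + 1)) := by
      have h1 : 2 * ((d : ℝ) + 1) * (S / 2 ^ (n + 1)) = (d + 1) * (S / 2 ^ n) := by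
        rw [pow_succ]; field_simp
      rw [h1]
      have h2 : S / 2 ^ n ≤ (d + 1) * (S / 2 ^ n) := le_mul_of_one_le_left (hs n).le hd1
      linarith [hKρ y]
    refine (lintegral_mono_set (dyadicGrid_subset_ball_of_mem hS hy)).trans
      ((hsize y _ (by have := hsS (n + 1); gcongr) hρy).trans ?_)
    exact hA.lintegral_ball_le hm h0 hν hC (hs _) hyK (dyadicGrid_subset_ball_of_mem hS hy)
      (hvol0 _ z) (hvol _ y z)
  · rintro n z ⟨y, hy, hyK⟩ hn
    have hnz : K * ρ z < S / 2 ^ (n + 1) := not_le.1 fun h =>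
      hn ⟨z, (dyadicGrid o S).mem_cell (n + 1) z, h⟩
    have h2 : S / 2 ^ (n + 1) ≤ (d + 1) * (S / 2 ^ (n + 1)) :=
      le_mul_of_one_le_left (hs _).le hd1
    have h3 : (d + 1) * (S / 2 ^ (n + 1)) ≤ (d + 1) * (S / 2 ^ n) := by
      gcongr
      · norm_num
      · simp
    have h4 : 0 < ((d : ℝ) + 1) * (S / 2 ^ n) := by have := hs n; positivity
    have h5 : ((d : ℝ) + 1) * (S / 2 ^ n) ≤ (d + 1) * S := by have := hsS n; gcongr
    have hball : ball z ((d + 1) * (S / 2 ^ (n + 1))) ⊆ ball y (2 * (d + 1) * (S / 2 ^ n)) := by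
      refine ball_subset_ball' ?_
      have h6 := dist_lt_of_mem_dyadicGrid hS hy
      rw [dist_comm] at h6
      linarith
    refine (lintegral_mono_set (dyadicGrid_subset_ball hS (n + 1) z)).trans
      ((hsize z _ (by linarith) (by linarith [hKρ z])).trans ((lintegral_mono_set hball).trans ?_))
    exact hA.lintegral_ball_le hm h0 hν hC (hs _) hyK (hsub hy) (hvol0 _ z)
      (volume_ball_le_dilationConst hS n y z)
  · exact fun b A hAt => ae_enorm_sub_le_dyadicGrid hf hw (fun z => (h0 z).le) o hS b hAt

end CriticalCells

section Balls

variable {d : ℕ} {ν K : ℝ} {ρ w : Rd d → ℝ} {C : ENNReal}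

/-- The weighted John–Nirenberg inequality on subcritical balls, for functions with normalized
oscillation. -/
theorem exists_lintegral_ball_le (hρ : ∀ x, 0 < ρ x) (hm : Measurable w) (h0 : ∀ z, 0 < w z)
    (hw : LocallyIntegrable w volume) (hν : 1 < ν) (hK : 1 ≤ K)
    (hA : LocalAp ρ w ν (2 * (d + 1) * K) C) (hC : C ≠ ⊤) :
    ∃ M : ENNReal, M ≠ ⊤ ∧ ∀ f : Rd d → ℝ, LocallyIntegrable f volume →
      ∀ (x : Rd d) (r : ℝ), 0 < r → 2 * r ≤ K * ρ x →
      (∀ y t, 0 < t → t ≤ 2 * (d + 1) * (2 * r) →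
        ∃ c, ∫⁻ z in ball y t, ‖f z - c‖ₑ ≤ ∫⁻ z in ball y t, ENNReal.ofReal (w z)) →
      (∀ y t, t ≤ 2 * (d + 1) * (2 * r) → ρ y ≤ t →
        ∫⁻ z in ball y t, ‖f z‖ₑ ≤ ∫⁻ z in ball y t, ENNReal.ofReal (w z)) →
      ∀ b : ℝ, (∀ a, ‖a - b‖ₑ * volume (ball x r) ≤ ∫⁻ z in ball x r, ‖f z - a‖ₑ) →
        ∫⁻ z in ball x r, ‖f z - b‖ₑ ^ ν * ENNReal.ofReal (w z) ^ (1 - ν) ≤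
          M * ∫⁻ z in ball x r, ENNReal.ofReal (w z) := by
  set D : ENNReal := 2 ^ (ν - 1) with hD
  have hν1 : 0 ≤ ν - 1 := by linarith
  have hν0 : 0 ≤ ν := by linarith
  have hD1 : 1 ≤ D := ENNReal.one_le_rpow (by norm_num) (by linarith)
  have hDt : D ≠ ⊤ := ENNReal.rpow_ne_top_of_nonneg hν1 (by norm_num)
  set C₁ := doublingConst d ν C with hC₁
  have hC₁t : C₁ ≠ ⊤ := doublingConst_ne_top hν hC
  set C₃ := C * dilationConst d ^ ν with hC₃
  have hC₃t : C₃ ≠ ⊤ :=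
    ENNReal.mul_ne_top hC (ENNReal.rpow_ne_top_of_nonneg hν0 dilationConst_ne_top)
  set A : ENNReal := 2 * (D * D * C₁) + 1 with hAdef
  have hAt : A ≠ ⊤ := by simp [hAdef, ENNReal.mul_eq_top, hDt, hC₁t]
  have hA0 : A ≠ 0 := by simp [hAdef]
  have hCA : C₁ ≤ A := by
    calc C₁ = 1 * (1 * 1 * C₁) := by simp
      _ ≤ 2 * (D * D * C₁) := by gcongr; norm_num
      _ ≤ A := le_self_add
  have hA2 : 2 ^ (ν - 1) * 2 ^ (ν - 1) * (C₁ / A) ≤ 2⁻¹ := by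
    rw [← mul_div_assoc, ENNReal.div_le_iff hA0 hAt, ← ENNReal.div_eq_inv_mul,
      ENNReal.le_div_iff_mul_le (Or.inl (by norm_num)) (Or.inl (by norm_num)), mul_comm]
    exact le_self_add
  set M₀ : ENNReal := 2 * (A ^ ν + D * (C₃ * (C₁ + A * C₁) ^ ν) +
        (C₃ * (C₁ + C₁) ^ ν + C₃ * (C₁ + A * C₁) ^ ν)) with hM₀
  have hM₀t : M₀ ≠ ⊤ := by
    have h1 : A ^ ν ≠ ⊤ := ENNReal.rpow_ne_top_of_nonneg hν0 hAt
    have h2 : (C₁ + A * C₁) ^ ν ≠ ⊤ := ENNReal.rpow_ne_top_of_nonneg hν0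
      (ENNReal.add_ne_top.2 ⟨hC₁t, ENNReal.mul_ne_top hAt hC₁t⟩)
    have h3 : (C₁ + C₁) ^ ν ≠ ⊤ := ENNReal.rpow_ne_top_of_nonneg hν0
      (ENNReal.add_ne_top.2 ⟨hC₁t, hC₁t⟩)
    have h4 := ENNReal.mul_ne_top hC₃t h2
    exact ENNReal.mul_ne_top (by norm_num) (ENNReal.add_ne_top.2 ⟨ENNReal.add_ne_top.2
      ⟨h1, ENNReal.mul_ne_top hDt h4⟩, ENNReal.add_ne_top.2 ⟨ENNReal.mul_ne_top hC₃t h3, h4⟩⟩)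
  refine ⟨D * (M₀ * C₁ + C₃ * (C₁ * C₁) ^ ν), ?_, ?_⟩
  · exact ENNReal.mul_ne_top hDt (ENNReal.add_ne_top.2 ⟨ENNReal.mul_ne_top hM₀t hC₁t,
      ENNReal.mul_ne_top hC₃t (ENNReal.rpow_ne_top_of_nonneg hν0
        (ENNReal.mul_ne_top hC₁t hC₁t))⟩)
  intro f hf x r hr hrK hosc hsize b hb
  set o : Rd d := WithLp.toLp 2 fun i => x i - r
  have hS : 0 < 2 * r := by positivity
  obtain ⟨a, ha⟩ := exists_cellOscillation (o := o) hρ hm h0 hw hν hK hA hC hf hS hosc hsize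
  set Q := (dyadicGrid o (2 * r)).cell 0 x with hQ
  have hBQ : ball x r ⊆ Q := ball_subset_dyadicGrid x hr
  have hgood : IsSubcritical ρ K o (2 * r) 0 x :=
    ⟨x, (dyadicGrid o (2 * r)).mem_cell 0 x, by simpa using hrK⟩
  have hQB : Q ⊆ ball x (2 * (d + 1) * (2 * r)) := by
    simpa using dyadicGrid_subset_ball_of_mem hS ((dyadicGrid o (2 * r)).mem_cell 0 x)
  have hB0 : volume (ball x r) ≠ 0 := (measure_ball_pos _ _ hr).ne'
  have hvol : volume (ball x (2 * (d + 1) * (2 * r))) ≤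
      dilationConst d * volume (ball x r) :=
    (volume_ball_le x x (s := r) (L := 4 * ((d : ℝ) + 1)) (by positivity) (by linarith)).trans
      (mul_le_mul_left (ENNReal.ofReal_le_ofReal (pow_le_pow_left₀ (by positivity)
        (le_mul_of_one_le_left (by positivity) (by norm_num)) d)) _)
  have hQW : ∫⁻ z in Q, ENNReal.ofReal (w z) ≤ C₁ * ∫⁻ z in ball x r, ENNReal.ofReal (w z) :=
    (lintegral_mono_set hQB).trans (hA.lintegral_ball_le hm h0 hν hC hS hrK (hBQ.trans hQB)
      hB0 hvol)
  have h1 : ∫⁻ z in ball x r, ‖f z - a 0 x‖ₑ ^ ν * ENNReal.ofReal (w z) ^ (1 - ν) ≤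
      M₀ * C₁ * ∫⁻ z in ball x r, ENNReal.ofReal (w z) := by
    refine (lintegral_mono_set hBQ).trans ((ha.lintegral_le hν hA0 hAt hCA hA2 hgood).trans ?_)
    rw [mul_assoc M₀]
    gcongr
  have h2 : ‖a 0 x - b‖ₑ * volume (ball x r) ≤
      C₁ * C₁ * ∫⁻ z in ball x r, ENNReal.ofReal (w z) := by
    refine (hb _).trans ((lintegral_mono_set hBQ).trans ((ha.osc hgood).trans ?_))
    rw [mul_assoc C₁]
    gcongr
  have h3 := hA.enorm_rpow_mul_le hm h0 hw hν hS hrK (hBQ.trans hQB) hB0 hvol _ _ h2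
  calc ∫⁻ z in ball x r, ‖f z - b‖ₑ ^ ν * ENNReal.ofReal (w z) ^ (1 - ν)
      ≤ ∫⁻ z in ball x r, (D * (‖f z - a 0 x‖ₑ ^ ν * ENNReal.ofReal (w z) ^ (1 - ν)) +
          D * (‖a 0 x - b‖ₑ ^ ν * ENNReal.ofReal (w z) ^ (1 - ν))) := by
        refine lintegral_mono fun z => ?_
        rw [← mul_assoc, ← mul_assoc, ← add_mul, ← mul_add]
        gcongr
        calc ‖f z - b‖ₑ ^ ν ≤ (‖f z - a 0 x‖ₑ + ‖a 0 x - b‖ₑ) ^ ν := by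
              gcongr
              rw [← sub_add_sub_cancel (f z) (a 0 x) b]
              exact enorm_add_le _ _
          _ ≤ _ := ENNReal.rpow_add_le_mul_rpow_add_rpow _ _ hν.le
    _ = D * (∫⁻ z in ball x r, ‖f z - a 0 x‖ₑ ^ ν * ENNReal.ofReal (w z) ^ (1 - ν)) +
          D * (‖a 0 x - b‖ₑ ^ ν * ∫⁻ z in ball x r, ENNReal.ofReal (w z) ^ (1 - ν)) := by
        have hWm : Measurable fun z => ENNReal.ofReal (w z) ^ (1 - ν) :=
          hm.ennreal_ofReal.pow_const _
        rw [lintegral_add_right _ ((hWm.const_mul _).const_mul _), lintegral_const_mul' _ _ hDt,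
          lintegral_const_mul' _ _ hDt, lintegral_const_mul _ hWm]
    _ ≤ D * (M₀ * C₁ * ∫⁻ z in ball x r, ENNReal.ofReal (w z)) +
          D * (C₃ * (C₁ * C₁) ^ ν * ∫⁻ z in ball x r, ENNReal.ofReal (w z)) := by gcongr
    _ = _ := by ring

end Balls

section Normalization

variable {d : ℕ} {α ν : ℝ} {ρ w f : Rd d → ℝ}

theorem lintegral_enorm_sub_le_of_ballInt_le (hf : LocallyIntegrable f volume)
    (hw : LocallyIntegrable w volume) (h0 : ∀ z, 0 ≤ w z) {y : Rd d} {t c E : ℝ} (hE : 0 < E)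
    (h : ballInt d y t (fun z => |f z - c|) ≤ E * ballInt d y t w) :
    ∫⁻ z in ball y t, ‖E⁻¹ * f z - E⁻¹ * c‖ₑ ≤ ∫⁻ z in ball y t, ENNReal.ofReal (w z) := by
  have hfi : IntegrableOn (fun z => E⁻¹ * f z - E⁻¹ * c) (ball y t) volume :=
    ((hf.integrableOn_ball y t).const_mul _).sub
      (integrableOn_const measure_ball_lt_top.ne)
  rw [← ofReal_integral_norm_eq_lintegral_enorm hfi, ← ofReal_ballInt hw h0]
  refine ENNReal.ofReal_le_ofReal ?_
  have h1 : ∀ z, ‖E⁻¹ * f z - E⁻¹ * c‖ = E⁻¹ * |f z - c| := fun z => by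
    rw [← mul_sub, norm_mul, Real.norm_of_nonneg (by positivity), Real.norm_eq_abs]
  simp_rw [h1]
  rw [integral_const_mul]
  exact (inv_mul_le_iff₀ hE).2 h

theorem enorm_sub_average_mul_le (hf : LocallyIntegrable f volume) (x : Rd d) {r : ℝ}
    (hr : 0 < r) (a E : ℝ) :
    ‖a - E⁻¹ * ballAvg d x r f‖ₑ * volume (ball x r) ≤
      ∫⁻ z in ball x r, ‖E⁻¹ * f z - a‖ₑ := by
  have hv := ballVol_pos_s3 x hr
  have hfi := (hf.integrableOn_ball x r).const_mul E⁻¹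
  have h1 : ∫ z in ball x r, (E⁻¹ * f z - a) =
      -((a - E⁻¹ * ballAvg d x r f) * ballVol d x r) := by
    rw [integral_sub hfi (integrableOn_const measure_ball_lt_top.ne), integral_const_mul,
      setIntegral_const, ballAvg, smul_eq_mul, measureReal_def, ← ballVol, ← ballInt]
    field_simp
    ring
  have h2 := enorm_integral_le_lintegral_enorm (μ := volume.restrict (ball x r))
    (fun z => E⁻¹ * f z - a)
  rwa [h1, enorm_neg, enorm_mul, Real.enorm_of_nonneg hv.le, ofReal_ballVol] at h2

theorem ballVol_le (x y : Rd d) {r t L : ℝ} (hL : 0 < L) (h : t ≤ L * r) :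
    ballVol d y t ≤ L ^ d * ballVol d x r := by
  have h1 := ENNReal.toReal_mono
    (ENNReal.mul_ne_top ENNReal.ofReal_ne_top measure_ball_lt_top.ne)
    (volume_ball_le y x (s := r) hL h)
  rwa [ENNReal.toReal_mul, ENNReal.toReal_ofReal (by positivity)] at h1

theorem ballInt_rpow_mul_le (hf : LocallyIntegrable f volume) (hw : LocallyIntegrable w volume)
    (hm : Measurable w) (h0 : ∀ z, 0 < w z) (hν : 1 < ν) {x : Rd d} {r c E : ℝ} (hE : 0 < E)
    {M : ENNReal} (hM : M ≠ ⊤)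
    (h : ∫⁻ z in ball x r, ‖E⁻¹ * f z - E⁻¹ * c‖ₑ ^ ν * ENNReal.ofReal (w z) ^ (1 - ν) ≤
      M * ∫⁻ z in ball x r, ENNReal.ofReal (w z)) :
    ballInt d x r (fun y => |f y - c| ^ ν * w y ^ (1 - ν)) ≤
      E ^ ν * M.toReal * ballInt d x r w := by
  have hEν : 0 < E ^ ν := by positivity
  have hI : 0 ≤ ballInt d x r w := integral_nonneg fun z => (h0 z).le
  have h1 : ∀ z, ENNReal.ofReal (|f z - c| ^ ν * w z ^ (1 - ν)) = ENNReal.ofReal (E ^ ν) *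
      (‖E⁻¹ * f z - E⁻¹ * c‖ₑ ^ ν * ENNReal.ofReal (w z) ^ (1 - ν)) := by
    intro z
    rw [Real.enorm_eq_ofReal_abs, ← mul_sub, abs_mul, abs_of_pos (inv_pos.2 hE),
      ENNReal.ofReal_rpow_of_nonneg (by positivity) (by linarith),
      ENNReal.ofReal_rpow_of_pos (h0 z), ← ENNReal.ofReal_mul (by positivity),
      ← ENNReal.ofReal_mul (by positivity), Real.mul_rpow (by positivity) (by positivity),
      Real.inv_rpow hE.le]
    congr 1
    field_simp
  rw [ballInt, integral_eq_lintegral_of_nonneg_ae]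
  · simp_rw [h1]
    rw [lintegral_const_mul' _ _ ENNReal.ofReal_ne_top]
    refine ENNReal.toReal_le_of_le_ofReal (by positivity) ?_
    rw [mul_assoc, ENNReal.ofReal_mul hEν.le, ENNReal.ofReal_mul ENNReal.toReal_nonneg,
      ENNReal.ofReal_toReal hM, ofReal_ballInt hw (fun z => (h0 z).le)]
    gcongr
  · exact Filter.Eventually.of_forall fun z => by
      have := h0 z
      simp only [Pi.zero_apply]
      positivity
  · have h2 : AEMeasurable (fun y => |f y - c|) (volume.restrict (ball x r)) :=
      (hf.aestronglyMeasurable.aemeasurable.restrict.sub_const c).norm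
    exact ((h2.pow_const ν).mul (hm.pow_const (1 - ν)).aemeasurable).aestronglyMeasurable

end Normalization

/-- Weighted self-improving inequality for `BMO^α_{L,w}` on sub-critical balls:
`|B|^{-α} (w(B)^{-1} ∫_B |f - f_B|^ν w^{1-ν})^{1/ν} ≤ C ‖f‖` for `0 < r ≤ c ρ(x)`. -/
theorem statement3 (d : ℕ) (hd : 3 ≤ d) (q : ℝ) (hq : (d : ℝ) / 2 < q)
    (V : Rd d → ℝ) (hV : IsRH d q V)
    (ρ : Rd d → ℝ) (hρ : ρ = criticalRadius d V) (hρpos : ∀ x, 0 < ρ x)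
    (p θ α ν : ℝ) (hp : 1 < p) (hθ : 0 < θ) (hα : 0 ≤ α) (hα1 : α < 1)
    (hν : 1 < ν) (hν' : ν ≤ p / (p - 1))
    (w : Rd d → ℝ) (hw : MemAp d p θ ρ w) :
    ∀ c : ℝ, 1 ≤ c → ∃ C > 0, ∀ f : Rd d → ℝ, MemBMO d α ρ w f →
      ∀ (x : Rd d) (r : ℝ), 0 < r → r ≤ c * ρ x →
        ballVol d x r ^ (-α) *
          ((ballInt d x r w)⁻¹ *
            ballInt d x r (fun y => |f y - ballAvg d x r f| ^ ν * w y ^ (1 - ν))) ^ (1/ν) ≤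
          C * bmoNorm d α ρ w f := by
  intro c hc
  have h0 := hw.1
  have hm := hw.2.1
  have hwi := hw.2.2.1
  obtain ⟨CA, hCA, hA⟩ := hw.lintegral_rpow_mul_le hρpos hp hθ hν hν' (2 * (d + 1) * (2 * c))
  obtain ⟨M, hM, hball⟩ := exists_lintegral_ball_le (K := 2 * c) hρpos hm h0 hwi hν (by linarith)
    hA hCA
  set L : ℝ := 4 * (d + 1) with hL
  have hLpos : 0 < L := by positivity
  set K₀ : ℝ := (L ^ d) ^ α * M.toReal ^ (1 / ν) with hK₀
  have hK₀nonneg : 0 ≤ K₀ := by positivity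
  refine ⟨K₀ + 1, by linarith, ?_⟩
  rintro f ⟨hf, C₀, hC₀, hbmo⟩ x r hr hrc
  have hvpos := ballVol_pos_s3 x hr
  have hIw0 : 0 ≤ ballInt d x r w := integral_nonneg fun z => (h0 z).le
  suffices h : ∀ C, 0 < C → BMOBound d α ρ w f C → ballVol d x r ^ (-α) *
      ((ballInt d x r w)⁻¹ *
        ballInt d x r (fun y => |f y - ballAvg d x r f| ^ ν * w y ^ (1 - ν))) ^ (1/ν) ≤
      K₀ * C by
    rw [← div_le_iff₀' (by linarith)]
    refine le_csInf ⟨C₀, hC₀, hbmo⟩ fun C hC => ?_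
    rw [div_le_iff₀' (by linarith)]
    refine (h C hC.1 hC.2).trans ?_
    have := hC.1
    gcongr
    linarith
  intro C hC hb
  set Λ : ℝ := (L ^ d * ballVol d x r) ^ α with hΛ
  have hΛpos : 0 < Λ := by positivity
  have hE : 0 < C * Λ := by positivity
  have hvol : ∀ y t, t ≤ 2 * (d + 1) * (2 * r) → C * (ballVol d y t ^ α * ballInt d y t w) ≤
      C * Λ * ballInt d y t w := by
    intro y t ht
    have h1 : ballVol d y t ≤ L ^ d * ballVol d x r := ballVol_le x y hLpos (by rw [hL]; linarith)
    have h2 : 0 ≤ ballInt d y t w := integral_nonneg fun z => (h0 z).le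
    have h3 : 0 ≤ ballVol d y t := ENNReal.toReal_nonneg
    rw [mul_assoc]
    gcongr
    exact Real.rpow_le_rpow h3 h1 hα
  have hlarge : ∀ y t, t ≤ 2 * (d + 1) * (2 * r) → ρ y ≤ t →
      ∫⁻ z in ball y t, ‖(C * Λ)⁻¹ * f z - (C * Λ)⁻¹ * 0‖ₑ ≤
        ∫⁻ z in ball y t, ENNReal.ofReal (w z) := fun y t ht hρt =>
    lintegral_enorm_sub_le_of_ballInt_le hf hwi (fun z => (h0 z).le) hE
      (by simpa using (hb.2 y t hρt).trans (hvol y t ht))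
  have key := hball (fun z => (C * Λ)⁻¹ * f z)
    (hf.smul (C * Λ)⁻¹) x r hr (by linarith)
    (fun y t ht0 ht => by
      rcases lt_or_ge t (ρ y) with hlt | hge
      · exact ⟨_, lintegral_enorm_sub_le_of_ballInt_le hf hwi (fun z => (h0 z).le) hE
          ((hb.1 y t ht0 hlt).trans (hvol y t ht))⟩
      · exact ⟨_, hlarge y t ht hge⟩)
    (fun y t ht hρt => by simpa using hlarge y t ht hρt)
    ((C * Λ)⁻¹ * ballAvg d x r f) (fun a => enorm_sub_average_mul_le hf x hr a _)
  have hreal := ballInt_rpow_mul_le hf hwi hm h0 hν hE hM key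
  have hν0 : 0 < ν := by linarith
  have hroot : ((ballInt d x r w)⁻¹ *
      ballInt d x r (fun y => |f y - ballAvg d x r f| ^ ν * w y ^ (1 - ν))) ^ (1 / ν) ≤
      C * Λ * M.toReal ^ (1 / ν) := by
    have hnn : 0 ≤ ballInt d x r (fun y => |f y - ballAvg d x r f| ^ ν * w y ^ (1 - ν)) :=
      integral_nonneg fun z => by
        have := h0 z
        simp only [Pi.zero_apply]
        positivity
    calc _ ≤ ((C * Λ) ^ ν * M.toReal) ^ (1 / ν) := by
          exact Real.rpow_le_rpow (by positivity)
            (inv_mul_le_of_le_mul₀ hIw0 (by positivity) (hreal.trans_eq (mul_comm _ _)))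
            (by positivity)
      _ = _ := by
          rw [Real.mul_rpow (by positivity) ENNReal.toReal_nonneg, ← Real.rpow_mul hE.le,
            mul_one_div_cancel hν0.ne', Real.rpow_one]
  calc _ ≤ ballVol d x r ^ (-α) * (C * Λ * M.toReal ^ (1 / ν)) := by gcongr
    _ = K₀ * C := by
      rw [hΛ, hK₀, Real.mul_rpow (by positivity) hvpos.le, Real.rpow_neg hvpos.le]
      field_simp
end
end
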